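/- Fix n ≥ 1 and let C be the set of pairs (e, B) where e = {g_0 < g_1} ranges over edges of Δ^{S_n} and B over blocks of 𝒫(Δ^{g_0,g_1}). The assignment sending an admissible map u : Δ^{S_n}_{(1)} → U(n) to the tuple (uwn_B(γ^{g_0,g_1}))_{(e,B) ∈ C} ∈ ℤ^C induces a well-defined bijection between the set of homotopy classes of admissible maps on the 1-skeleton (where a homotopy is a homotopy through admissible maps) and ℤ^C. -/

import Mathlib

/-- The permutation matrix `U_g`, with `U_g e_i = e_{g i}`. -/
def permMat {n : ℕ} (g : Equiv.Perm (Fin n)) : Matrix (Fin n) (Fin n) ℂ :=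
  Matrix.of fun i j => if i = g j then 1 else 0

/-- `i` and `j` lie in the same orbit of the subgroup `G` of `S_n`. -/
def sameOrbit {n : ℕ} (G : Subgroup (Equiv.Perm (Fin n))) (i j : Fin n) : Prop :=
  ∃ p ∈ G, p i = j

/-- The subgroup of `S_n` generated by the differences `g⁻¹ * h` of elements of `S`;
for `S = {g₀, …, g_l}` it is the subgroup generated by `g₀⁻¹g₁, …, g₀⁻¹g_l`. -/
def groupOf {n : ℕ} (S : Finset (Equiv.Perm (Fin n))) : Subgroup (Equiv.Perm (Fin n)) :=
  Subgroup.closure {q | ∃ g ∈ S, ∃ h ∈ S, q = g⁻¹ * h}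

/-- The `k`-skeleton `Δ^{S_n}_{(k)}` of the simplex with vertices indexed by `S_n`:
points of the simplex with at most `k+1` nonzero coordinates. -/
def skel (n k : ℕ) : Set (Equiv.Perm (Fin n) → ℝ) :=
  {x | (∀ g, 0 ≤ x g) ∧ (∑ g, x g) = 1 ∧
    (Finset.univ.filter fun g => x g ≠ 0).card ≤ k + 1}

/-- The vertex of the simplex corresponding to `g ∈ S_n`. -/
def vertex {n : ℕ} (g : Equiv.Perm (Fin n)) : Equiv.Perm (Fin n) → ℝ :=
  fun h => if h = g then 1 else 0

/-- A weakly admissible map on the `k`-skeleton: a continuous map `u` into `U(n)` such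
that for every subsimplex `Δ^{g₀,…,g_l}` (support finset `S`, `l ≤ k`) and every point `x`
of it, `u x` lies in the coset `U_g · U(𝒫(Δ^{g₀,…,g_l}))` for `g ∈ S`; equivalently the
matrix `U_g⁻¹ · u x`, whose `(i,j)` entry is `u x (g i) j`, is block diagonal for the
orbit partition of the subgroup generated by the `g₀⁻¹gᵢ`. -/
def WeaklyAdmissible (n k : ℕ)
    (u : (Equiv.Perm (Fin n) → ℝ) → Matrix (Fin n) (Fin n) ℂ) : Prop :=
  ContinuousOn u (skel n k) ∧
  (∀ x ∈ skel n k, u x ∈ Matrix.unitaryGroup (Fin n) ℂ) ∧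
  ∀ S : Finset (Equiv.Perm (Fin n)), S.Nonempty → S.card ≤ k + 1 →
    ∀ x ∈ skel n k, (∀ g ∉ S, x g = 0) →
      ∀ g ∈ S, ∀ i j : Fin n, ¬ sameOrbit (groupOf S) i j → u x (g i) j = 0

/-- An admissible map on the `k`-skeleton: weakly admissible and sending every vertex `g`
to the permutation matrix `U_g`. -/
def Admissible (n k : ℕ)
    (u : (Equiv.Perm (Fin n) → ℝ) → Matrix (Fin n) (Fin n) ℂ) : Prop :=
  WeaklyAdmissible n k u ∧ ∀ g : Equiv.Perm (Fin n), u (vertex g) = permMat g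

/-- Determinant of the `B × B` submatrix of `M`. -/
noncomputable def blockDet {n : ℕ} (B : Finset (Fin n)) (M : Matrix (Fin n) (Fin n) ℂ) : ℂ :=
  (M.submatrix (fun i : {x // x ∈ B} => i.1) (fun j : {x // x ∈ B} => j.1)).det

/-- `B` is a block (equivalence class) of the relation `r`. -/
def IsBlock {n : ℕ} (r : Fin n → Fin n → Prop) (B : Finset (Fin n)) : Prop :=
  ∃ i, ∀ j, j ∈ B ↔ r i j

/-- `l` is a continuous lift of `f` on `[0,1]` through `x ↦ exp (2 π i x)`. -/
def IsLiftOn (f : ℝ → ℂ) (l : ℝ → ℝ) : Prop :=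
  ContinuousOn l (Set.Icc 0 1) ∧
    ∀ t ∈ Set.Icc (0 : ℝ) 1, f t = Complex.exp (2 * Real.pi * Complex.I * l t)

/-- The point `ε^{g₀,g₁}(t) = (1 - t)·g₀ + t·g₁` of the edge `Δ^{g₀,g₁}`. -/
def edgePt {n : ℕ} (g0 g1 : Equiv.Perm (Fin n)) (t : ℝ) : Equiv.Perm (Fin n) → ℝ :=
  fun h => (1 - t) * (if h = g0 then 1 else 0) + t * (if h = g1 then 1 else 0)

/-- The path `γ^{g₀,g₁} = U_{g₀}⁻¹ · (u ∘ ε^{g₀,g₁})`; the `(i,j)` entry of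
`U_{g₀}⁻¹ · M` is `M (g₀ i) j`. -/
def edgePath {n : ℕ} (u : (Equiv.Perm (Fin n) → ℝ) → Matrix (Fin n) (Fin n) ℂ)
    (g0 g1 : Equiv.Perm (Fin n)) (t : ℝ) : Matrix (Fin n) (Fin n) ℂ :=
  Matrix.of fun i j => u (edgePt g0 g1 t) (g0 i) j

/-- A homotopy through admissible maps on the 1-skeleton between `u` and `u'`. -/
def AdmHomotopic (n : ℕ)
    (u u' : (Equiv.Perm (Fin n) → ℝ) → Matrix (Fin n) (Fin n) ℂ) : Prop :=
  ∃ H : ℝ → (Equiv.Perm (Fin n) → ℝ) → Matrix (Fin n) (Fin n) ℂ,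
    ContinuousOn (fun p : ℝ × (Equiv.Perm (Fin n) → ℝ) => H p.1 p.2)
      (Set.Icc 0 1 ×ˢ skel n 1) ∧
    (∀ s ∈ Set.Icc (0 : ℝ) 1, Admissible n 1 (H s)) ∧
    (∀ x ∈ skel n 1, H 0 x = u x) ∧ (∀ x ∈ skel n 1, H 1 x = u' x)

section

open Matrix unitInterval

section UnitaryLoops

variable {ι : Type*} [Fintype ι] [DecidableEq ι]

/-- The subgroup of unitary matrices fixing every standard basis vector outside `A`. -/
def supportedUnitary (A : Finset ι) : Subgroup (unitaryGroup ι ℂ) where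
  carrier := {M | ∀ j ∉ A, M.1 *ᵥ Pi.single j 1 = Pi.single j 1}
  one_mem' := fun j _ => one_mulVec _
  mul_mem' := fun {M N} hM hN j hj => by
    rw [Submonoid.coe_mul, ← mulVec_mulVec, hN j hj, hM j hj]
  inv_mem' := fun {M} hM j hj => by
    have h : (M⁻¹).1 * M.1 = 1 := by rw [← Submonoid.coe_mul, inv_mul_cancel]; rfl
    calc (M⁻¹).1 *ᵥ Pi.single j 1 = (M⁻¹).1 *ᵥ (M.1 *ᵥ Pi.single j 1) := by rw [hM j hj]
      _ = Pi.single j 1 := by rw [mulVec_mulVec, h, one_mulVec]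

theorem supportedUnitary_erase {A : Finset ι} {a : ι} {M : unitaryGroup ι ℂ}
    (hM : M ∈ supportedUnitary A) (ha : M.1 *ᵥ Pi.single a 1 = Pi.single a 1) :
    M ∈ supportedUnitary (A.erase a) := by
  intro j hj
  by_cases h : j = a
  · subst h; exact ha
  · exact hM j fun hA => hj (Finset.mem_erase.2 ⟨h, hA⟩)

theorem supportedUnitary_mono {A B : Finset ι} (h : A ⊆ B) :
    supportedUnitary A ≤ supportedUnitary B :=
  fun _ hM j hj => hM j fun hA => hj (h hA)

theorem coe_inv_unitary (M : unitaryGroup ι ℂ) : (M⁻¹).1 = M.1ᴴ := rfl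

theorem supportedUnitary_apply_of_col {A : Finset ι} {M : unitaryGroup ι ℂ}
    (hM : M ∈ supportedUnitary A) (i : ι) {j : ι} (hj : j ∉ A) :
    M.1 i j = (1 : Matrix ι ι ℂ) i j := by
  have := congrFun (hM j hj) i
  rw [mulVec_single_one] at this
  simpa [Matrix.one_apply, Pi.single_apply] using this

theorem supportedUnitary_apply_of_row {A : Finset ι} {M : unitaryGroup ι ℂ}
    (hM : M ∈ supportedUnitary A) {i : ι} (hi : i ∉ A) (j : ι) :
    M.1 i j = (1 : Matrix ι ι ℂ) i j := by
  have := supportedUnitary_apply_of_col (inv_mem hM) j hi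
  rw [coe_inv_unitary, conjTranspose_apply] at this
  rw [← star_star (M.1 i j), this, Matrix.one_apply, Matrix.one_apply]
  by_cases h : i = j
  · subst h; simp
  · simp [h, Ne.symm h]

/-- A matrix as an element of the unitary group, with junk value `1` if it is not unitary. -/
noncomputable def toUnitary (M : Matrix ι ι ℂ) : unitaryGroup ι ℂ :=
  open Classical in if h : M ∈ unitaryGroup ι ℂ then ⟨M, h⟩ else 1

theorem coe_toUnitary {M : Matrix ι ι ℂ} (h : M ∈ unitaryGroup ι ℂ) :
    (toUnitary M).1 = M := by
  rw [toUnitary, dif_pos h]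

theorem toUnitary_one : toUnitary (1 : Matrix ι ι ℂ) = 1 :=
  Subtype.ext (coe_toUnitary (one_mem _))

theorem continuous_toUnitary {X : Type*} [TopologicalSpace X] {M : X → Matrix ι ι ℂ}
    (hM : Continuous M) (h : ∀ x, M x ∈ unitaryGroup ι ℂ) :
    Continuous fun x => toUnitary (M x) := by
  rw [continuous_induced_rng]
  convert hM using 1
  funext x
  exact coe_toUnitary (h x)

/-- The determinant of a unitary matrix as a point of the circle. -/
noncomputable def circleDet : unitaryGroup ι ℂ →* Circle where
  toFun M := ⟨M.1.det, mem_sphere_zero_iff_norm.2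
    (CStarRing.norm_of_mem_unitary (det_of_mem_unitary M.2))⟩
  map_one' := by ext; simp
  map_mul' M N := Circle.ext (det_mul M.1 N.1)

theorem coe_circleDet (M : unitaryGroup ι ℂ) : (circleDet M : ℂ) = M.1.det := rfl

theorem continuous_circleDet : Continuous (circleDet : unitaryGroup ι ℂ → Circle) :=
  Continuous.subtype_mk (Continuous.matrix_det continuous_subtype_val) _

/-- The diagonal unitary matrix with entries on the circle. -/
noncomputable def diagUnitary : (ι → Circle) →* unitaryGroup ι ℂ where
  toFun z := ⟨diagonal fun i => (z i : ℂ), by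
    rw [mem_unitaryGroup_iff, star_eq_conjTranspose, diagonal_conjTranspose, diagonal_mul_diagonal,
      ← diagonal_one]
    congr 1; funext i
    simp [Complex.mul_conj]⟩
  map_one' := by ext; simp
  map_mul' z w := by
    apply Subtype.ext
    simp [diagonal_mul_diagonal]

theorem coe_diagUnitary (z : ι → Circle) :
    (diagUnitary z).1 = diagonal fun i => (z i : ℂ) := rfl

theorem continuous_diagUnitary : Continuous (diagUnitary : (ι → Circle) → unitaryGroup ι ℂ) := by
  rw [continuous_induced_rng]
  exact Continuous.matrix_diagonal (by fun_prop)

theorem circleDet_diagUnitary (z : ι → Circle) : circleDet (diagUnitary z) = ∏ i, z i := by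
  ext
  rw [coe_circleDet, coe_diagUnitary, det_diagonal]
  exact (map_prod Circle.coeHom z Finset.univ).symm

theorem diagUnitary_mem_supportedUnitary {A : Finset ι} {z : ι → Circle}
    (hz : ∀ i ∉ A, z i = 1) : diagUnitary z ∈ supportedUnitary A := by
  intro j hj
  rw [coe_diagUnitary, mulVec_single_one]
  funext i
  by_cases h : i = j
  · subst h; simp [hz i hj]
  · simp [h]

/-- Null-homotopic loops at `1` in a subgroup. -/
def NullLoop {G : Type*} [Group G] [TopologicalSpace G] (S : Subgroup G) (γ : I → G) : Prop :=
  ∃ K : I × I → G, Continuous K ∧ (∀ p, K p ∈ S) ∧ (∀ t, K (0, t) = γ t) ∧ (∀ t, K (1, t) = 1) ∧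
    (∀ s, K (s, 0) = 1) ∧ ∀ s, K (s, 1) = 1

namespace NullLoop

variable {G : Type*} [Group G] [TopologicalSpace G] {S T : Subgroup G} {γ δ : I → G}

theorem mono (h : NullLoop S γ) (hST : S ≤ T) : NullLoop T γ := by
  obtain ⟨K, h1, h2, h3⟩ := h
  exact ⟨K, h1, fun p => hST (h2 p), h3⟩

theorem continuous (h : NullLoop S γ) : Continuous γ := by
  obtain ⟨K, h1, -, h3, -⟩ := h
  have : γ = fun t => K (0, t) := funext fun t => (h3 t).symm
  rw [this]; fun_prop

theorem mem (h : NullLoop S γ) (t : I) : γ t ∈ S := by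
  obtain ⟨K, -, h2, h3, -⟩ := h
  exact h3 t ▸ h2 _

theorem zero (h : NullLoop S γ) : γ 0 = 1 := by
  obtain ⟨K, -, -, h3, -, h5, -⟩ := h
  rw [← h3, h5]

theorem one (h : NullLoop S γ) : γ 1 = 1 := by
  obtain ⟨K, -, -, h3, -, -, h6⟩ := h
  rw [← h3, h6]

theorem refl : NullLoop S (fun _ => (1 : G)) :=
  ⟨fun _ => 1, continuous_const, fun _ => one_mem _, by simp⟩

theorem mul [IsTopologicalGroup G] (h : NullLoop S γ) (h' : NullLoop S δ) :
    NullLoop S fun t => γ t * δ t := by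
  obtain ⟨K, a1, a2, a3, a4, a5, a6⟩ := h
  obtain ⟨L, b1, b2, b3, b4, b5, b6⟩ := h'
  exact ⟨fun p => K p * L p, a1.mul b1, fun p => mul_mem (a2 p) (b2 p), by simp [*], by simp [*],
    by simp [*], by simp [*]⟩

theorem inv [IsTopologicalGroup G] (h : NullLoop S γ) : NullLoop S fun t => (γ t)⁻¹ := by
  obtain ⟨K, a1, a2, a3, a4, a5, a6⟩ := h
  exact ⟨fun p => (K p)⁻¹, a1.inv, fun p => inv_mem (a2 p), by simp [*], by simp [*],
    by simp [*], by simp [*]⟩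

theorem map {H : Type*} [Group H] [TopologicalSpace H] {T : Subgroup H} {f : G → H}
    (h : NullLoop S γ) (hf : Continuous f) (hf1 : f 1 = 1) (hfS : ∀ x ∈ S, f x ∈ T) :
    NullLoop T fun t => f (γ t) := by
  obtain ⟨K, a1, a2, a3, a4, a5, a6⟩ := h
  exact ⟨fun p => f (K p), hf.comp a1, fun p => hfS _ (a2 p), by simp [*], by simp [*],
    by simp [*], by simp [*]⟩

end NullLoop

/-- The diagonal matrix with entry `z` at `b` and `1` elsewhere. -/
noncomputable def diagAt (b : ι) (z : Circle) : unitaryGroup ι ℂ := diagUnitary (Pi.mulSingle b z)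

theorem continuous_diagAt (b : ι) : Continuous (diagAt b) :=
  continuous_diagUnitary.comp (continuous_mulSingle (A := fun _ : ι => Circle) b)

theorem diagAt_one (b : ι) : diagAt b 1 = 1 := by
  rw [diagAt, Pi.mulSingle_one, map_one]

theorem circleDet_diagAt (b : ι) (z : Circle) : circleDet (diagAt b z) = z := by
  rw [diagAt, circleDet_diagUnitary, Finset.prod_pi_mulSingle']
  simp

theorem diagAt_mem {A : Finset ι} {b : ι} (hb : b ∈ A) (z : Circle) :
    diagAt b z ∈ supportedUnitary A :=
  diagUnitary_mem_supportedUnitary fun _ hi =>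
    Pi.mulSingle_eq_of_ne (M := fun _ : ι => Circle) (ne_of_mem_of_not_mem hb hi).symm z

end UnitaryLoops

section UnitVectors

variable {ι : Type*} [Fintype ι]

theorem dotProduct_star_ne_one {x y : ι → ℂ} (hx : star x ⬝ᵥ x = 1) (hy : star y ⬝ᵥ y = 1)
    (h : x ≠ y) : star y ⬝ᵥ x ≠ 1 := by
  intro h1
  have h2 : star x ⬝ᵥ y = 1 := by
    have := star_dotProduct x y
    rw [this, h1, star_one]
  have h3 : star (y - x) ⬝ᵥ (y - x) = 0 := by
    rw [star_sub, sub_dotProduct, dotProduct_sub, dotProduct_sub, hx, hy, h1, h2]; ring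
  open scoped ComplexOrder in
  exact h (sub_eq_zero.1 (dotProduct_star_self_eq_zero.1 h3)).symm

theorem star_neg_dotProduct_neg (x : ι → ℂ) : star (-x) ⬝ᵥ (-x) = star x ⬝ᵥ x := by
  rw [star_neg, neg_dotProduct_neg]

theorem ne_neg_self_of_unit {x : ι → ℂ} (hx : star x ⬝ᵥ x = 1) : x ≠ -x := by
  intro h
  have : x = 0 := self_eq_neg.1 h
  simp [this] at hx

/-- The Euclidean length of a complex vector. -/
noncomputable def vecLength (x : ι → ℂ) : ℝ := ‖WithLp.toLp 2 x‖

theorem star_dotProduct_self (x : ι → ℂ) : star x ⬝ᵥ x = ((vecLength x : ℝ) : ℂ) ^ 2 := by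
  rw [vecLength, ← Complex.ofReal_pow, EuclideanSpace.norm_sq_eq]
  simp [dotProduct, Complex.conj_mul']

theorem vecLength_eq_one {x : ι → ℂ} : vecLength x = 1 ↔ star x ⬝ᵥ x = 1 := by
  rw [star_dotProduct_self, ← Complex.ofReal_pow]
  norm_cast
  exact (pow_eq_one_iff_of_nonneg (norm_nonneg _) two_ne_zero).symm

theorem vecLength_smul (c : ℝ) (x : ι → ℂ) : vecLength (c • x) = |c| * vecLength x := by
  rw [vecLength, WithLp.toLp_smul, norm_smul, Real.norm_eq_abs, vecLength]

theorem vecLength_pos {x : ι → ℂ} : 0 < vecLength x ↔ x ≠ 0 := by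
  rw [vecLength, norm_pos_iff, ne_eq, WithLp.toLp_eq_zero]

theorem continuous_vecLength : Continuous (vecLength : (ι → ℂ) → ℝ) :=
  (PiLp.continuous_toLp 2 _).norm

/-- The unit vector in the direction of `x`. -/
noncomputable def unitVec (x : ι → ℂ) : ι → ℂ := (vecLength x)⁻¹ • x

theorem unitVec_unit {x : ι → ℂ} (hx : x ≠ 0) : star (unitVec x) ⬝ᵥ unitVec x = 1 := by
  have := vecLength_pos.2 hx
  rw [← vecLength_eq_one, unitVec, vecLength_smul, abs_of_pos (inv_pos.2 this),
    inv_mul_cancel₀ this.ne']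

theorem unitVec_of_unit {x : ι → ℂ} (hx : star x ⬝ᵥ x = 1) : unitVec x = x := by
  rw [unitVec, vecLength_eq_one.2 hx, inv_one, one_smul]

theorem smul_unitVec {x : ι → ℂ} (hx : x ≠ 0) : vecLength x • unitVec x = x := by
  rw [unitVec, smul_smul, mul_inv_cancel₀ (vecLength_pos.2 hx).ne', one_smul]

theorem unitVec_apply_eq_zero {x : ι → ℂ} {i : ι} (hx : x i = 0) : unitVec x i = 0 := by
  simp [unitVec, hx]

theorem continuous_unitVec {X : Type*} [TopologicalSpace X] {x : X → ι → ℂ}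
    (hxc : Continuous x) (hx : ∀ p, x p ≠ 0) : Continuous fun p => unitVec (x p) :=
  ((continuous_vecLength.comp hxc).inv₀ fun p => (vecLength_pos.2 (hx p)).ne').smul hxc

/-- A segment between non-antipodal unit vectors avoids the ray opposite to the first. -/
theorem segment_ne_neg_smul {x y : ι → ℂ} (hx : star x ⬝ᵥ x = 1) (hy : star y ⬝ᵥ y = 1)
    (h : y ≠ -x) {s c : ℝ} (hs0 : 0 ≤ s) (hs1 : s ≤ 1) (hc : 0 ≤ c) :
    (1 - s) • x + s • y ≠ (-c) • x := by
  intro heq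
  have h1 : s • y = (-(c + (1 - s))) • x := by
    calc s • y = ((1 - s) • x + s • y) - (1 - s) • x := by abel
      _ = (-(c + (1 - s))) • x := by rw [heq]; module
  have h2 := congrArg vecLength h1
  rw [vecLength_smul, vecLength_smul, vecLength_eq_one.2 hx, vecLength_eq_one.2 hy, abs_neg,
    abs_of_nonneg hs0, abs_of_nonneg (by linarith), mul_one, mul_one] at h2
  have hs : s ≠ 0 := by rintro rfl; linarith
  rw [← h2, neg_smul, ← smul_neg] at h1
  exact h (smul_right_injective _ hs h1)

theorem segment_ne_zero {x y : ι → ℂ} (hx : star x ⬝ᵥ x = 1) (hy : star y ⬝ᵥ y = 1)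
    (h : y ≠ -x) {s : ℝ} (hs0 : 0 ≤ s) (hs1 : s ≤ 1) : (1 - s) • x + s • y ≠ 0 := by
  simpa using segment_ne_neg_smul hx hy h hs0 hs1 le_rfl

theorem unitVec_segment_ne_neg {x y : ι → ℂ} (hx : star x ⬝ᵥ x = 1) (hy : star y ⬝ᵥ y = 1)
    (h : y ≠ -x) {s : ℝ} (hs0 : 0 ≤ s) (hs1 : s ≤ 1) :
    unitVec ((1 - s) • x + s • y) ≠ -x := by
  intro heq
  have h0 := segment_ne_zero hx hy h hs0 hs1
  refine segment_ne_neg_smul hx hy h hs0 hs1 (vecLength_pos.2 h0).le ?_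
  rw [neg_smul, ← smul_neg, ← heq]
  exact (smul_unitVec h0).symm

end UnitVectors

section Householder

variable {ι : Type*} [Fintype ι] [DecidableEq ι]

/-- The complex reflection mapping the unit vector `x` to the unit vector `y ≠ x`. -/
noncomputable def reflectionMatrix (x y : ι → ℂ) : Matrix ι ι ℂ :=
  1 - (1 - star y ⬝ᵥ x)⁻¹ • vecMulVec (y - x) (star (y - x))

theorem star_reflectionMatrix (x y : ι → ℂ) :
    star (reflectionMatrix x y) = reflectionMatrix y x := by
  have h : star (star y ⬝ᵥ x) = star x ⬝ᵥ y := (star_dotProduct x y).symm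
  rw [star_eq_conjTranspose, reflectionMatrix, reflectionMatrix, conjTranspose_sub,
    conjTranspose_smul, conjTranspose_vecMulVec, conjTranspose_one, star_star, star_inv₀,
    star_sub, star_one, h, ← neg_sub y x, star_neg, vecMulVec_neg, neg_vecMulVec, neg_neg]

theorem reflectionMatrix_mul_symm {x y : ι → ℂ} (hx : star x ⬝ᵥ x = 1) (hy : star y ⬝ᵥ y = 1)
    (h : x ≠ y) : reflectionMatrix x y * reflectionMatrix y x = 1 := by
  have h1 := sub_ne_zero.2 (dotProduct_star_ne_one hx hy h).symm
  have h2 := sub_ne_zero.2 (dotProduct_star_ne_one hy hx h.symm).symm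
  have hw : star (y - x) ⬝ᵥ (y - x) = (1 - star y ⬝ᵥ x) + (1 - star x ⬝ᵥ y) := by
    rw [star_sub, sub_dotProduct, dotProduct_sub, dotProduct_sub, hx, hy]; ring
  have hW : vecMulVec (y - x) (star (y - x)) * vecMulVec (y - x) (star (y - x)) =
      ((1 - star y ⬝ᵥ x) + (1 - star x ⬝ᵥ y)) • vecMulVec (y - x) (star (y - x)) := by
    rw [vecMulVec_mul_vecMulVec, hw, vecMulVec_smul]
  rw [reflectionMatrix, reflectionMatrix, ← neg_sub y x, star_neg, vecMulVec_neg, neg_vecMulVec,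
    neg_neg, sub_mul, mul_sub, mul_sub, one_mul, mul_one, one_mul, smul_mul_smul_comm, hW,
    smul_smul]
  have : (1 - star y ⬝ᵥ x)⁻¹ * (1 - star x ⬝ᵥ y)⁻¹ * (1 - star y ⬝ᵥ x + (1 - star x ⬝ᵥ y)) =
      (1 - star x ⬝ᵥ y)⁻¹ + (1 - star y ⬝ᵥ x)⁻¹ := by
    field_simp
  rw [this, add_smul]
  abel

theorem reflectionMatrix_mem {x y : ι → ℂ} (hx : star x ⬝ᵥ x = 1) (hy : star y ⬝ᵥ y = 1)
    (h : x ≠ y) : reflectionMatrix x y ∈ unitaryGroup ι ℂ := by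
  rw [mem_unitaryGroup_iff, star_reflectionMatrix]
  exact reflectionMatrix_mul_symm hx hy h

theorem reflectionMatrix_mulVec_eq (x y v : ι → ℂ) : reflectionMatrix x y *ᵥ v =
    v - ((1 - star y ⬝ᵥ x)⁻¹ * (star (y - x) ⬝ᵥ v)) • (y - x) := by
  rw [reflectionMatrix, sub_mulVec, one_mulVec, smul_mulVec, vecMulVec_mulVec, op_smul_eq_smul,
    smul_smul]

/-- The complex reflection mapping `x` to `y` as a unitary matrix. -/
noncomputable def reflectTo (x y : ι → ℂ) : unitaryGroup ι ℂ := toUnitary (reflectionMatrix x y)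

theorem reflectTo_mul_symm {x y : ι → ℂ} (hx : star x ⬝ᵥ x = 1) (hy : star y ⬝ᵥ y = 1)
    (h : x ≠ y) : reflectTo x y * reflectTo y x = 1 := by
  apply Subtype.ext
  rw [Submonoid.coe_mul, reflectTo, reflectTo, coe_toUnitary (reflectionMatrix_mem hx hy h),
    coe_toUnitary (reflectionMatrix_mem hy hx h.symm)]
  exact reflectionMatrix_mul_symm hx hy h

theorem reflectTo_mulVec {x y : ι → ℂ} (hx : star x ⬝ᵥ x = 1) (hy : star y ⬝ᵥ y = 1)
    (h : x ≠ y) : (reflectTo x y).1 *ᵥ x = y := by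
  have h1 := sub_ne_zero.2 (dotProduct_star_ne_one hx hy h).symm
  rw [reflectTo, coe_toUnitary (reflectionMatrix_mem hx hy h), reflectionMatrix_mulVec_eq]
  have : (1 - star y ⬝ᵥ x)⁻¹ * (star (y - x) ⬝ᵥ x) = -1 := by
    rw [star_sub, sub_dotProduct, hx]
    field_simp
    ring
  rw [this, neg_one_smul]
  abel

theorem reflectTo_mem {A : Finset ι} {x y : ι → ℂ} (hx : star x ⬝ᵥ x = 1) (hy : star y ⬝ᵥ y = 1)
    (h : x ≠ y) (hxA : ∀ i ∉ A, x i = 0) (hyA : ∀ i ∉ A, y i = 0) :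
    reflectTo x y ∈ supportedUnitary A := by
  intro j hj
  rw [reflectTo, coe_toUnitary (reflectionMatrix_mem hx hy h), reflectionMatrix_mulVec_eq]
  simp [hxA j hj, hyA j hj]

theorem continuous_reflectTo {X : Type*} [TopologicalSpace X] {x y : X → ι → ℂ}
    (hxc : Continuous x) (hyc : Continuous y) (hx : ∀ p, star (x p) ⬝ᵥ x p = 1)
    (hy : ∀ p, star (y p) ⬝ᵥ y p = 1) (h : ∀ p, x p ≠ y p) :
    Continuous fun p => reflectTo (x p) (y p) := by
  refine continuous_toUnitary ?_ fun p => reflectionMatrix_mem (hx p) (hy p) (h p)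
  have h1 : Continuous fun p => (1 - star (y p) ⬝ᵥ x p)⁻¹ := by
    refine Continuous.inv₀ ?_ fun p =>
      sub_ne_zero.2 (dotProduct_star_ne_one (hx p) (hy p) (h p)).symm
    exact continuous_const.sub ((hyc.star).dotProduct hxc)
  exact continuous_const.sub
    (h1.smul ((hyc.sub hxc).matrix_vecMulVec (hyc.sub hxc).star))

/-- A unitary matrix mapping the unit vector `x` to the unit vector `y ≠ -x`, depending
continuously on both and equal to `1` for `x = y`. -/
noncomputable def rotateTo (x y : ι → ℂ) : unitaryGroup ι ℂ := reflectTo (-x) y * reflectTo x (-x)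

theorem rotateTo_self {x : ι → ℂ} (hx : star x ⬝ᵥ x = 1) : rotateTo x x = 1 :=
  reflectTo_mul_symm (by rwa [star_neg_dotProduct_neg]) hx (ne_neg_self_of_unit hx).symm

theorem rotateTo_mulVec {x y : ι → ℂ} (hx : star x ⬝ᵥ x = 1) (hy : star y ⬝ᵥ y = 1)
    (h : y ≠ -x) : (rotateTo x y).1 *ᵥ x = y := by
  have hx' : star (-x) ⬝ᵥ (-x) = 1 := by rwa [star_neg_dotProduct_neg]
  rw [rotateTo, Submonoid.coe_mul, ← mulVec_mulVec,
    reflectTo_mulVec hx hx' (ne_neg_self_of_unit hx), reflectTo_mulVec hx' hy h.symm]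

theorem rotateTo_mem {A : Finset ι} {x y : ι → ℂ} (hx : star x ⬝ᵥ x = 1) (hy : star y ⬝ᵥ y = 1)
    (h : y ≠ -x) (hxA : ∀ i ∉ A, x i = 0) (hyA : ∀ i ∉ A, y i = 0) :
    rotateTo x y ∈ supportedUnitary A := by
  have hx' : star (-x) ⬝ᵥ (-x) = 1 := by rwa [star_neg_dotProduct_neg]
  have hxA' : ∀ i ∉ A, (-x) i = 0 := fun i hi => by simp [hxA i hi]
  exact mul_mem (reflectTo_mem hx' hy h.symm hxA' hyA)
    (reflectTo_mem hx hx' (ne_neg_self_of_unit hx) hxA hxA')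

theorem continuous_rotateTo {X : Type*} [TopologicalSpace X] {x y : X → ι → ℂ}
    (hxc : Continuous x) (hyc : Continuous y) (hx : ∀ p, star (x p) ⬝ᵥ x p = 1)
    (hy : ∀ p, star (y p) ⬝ᵥ y p = 1) (h : ∀ p, y p ≠ -x p) :
    Continuous fun p => rotateTo (x p) (y p) := by
  have hx' : ∀ p, star (-x p) ⬝ᵥ (-x p) = 1 := fun p => by rw [star_neg_dotProduct_neg, hx]
  exact (continuous_reflectTo hxc.neg hyc hx' hy fun p => (h p).symm).mul
    (continuous_reflectTo hxc hxc.neg hx hx' fun p => ne_neg_self_of_unit (hx p))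

end Householder

section Approximation

theorem exists_polynomial_near_eq_endpoints {f : ℝ → ℝ} (hf : ContinuousOn f (Set.Icc 0 1))
    {ε : ℝ} (hε : 0 < ε) : ∃ P : Polynomial ℝ,
      (∀ x ∈ Set.Icc (0 : ℝ) 1, |P.eval x - f x| < ε) ∧ P.eval 0 = f 0 ∧ P.eval 1 = f 1 := by
  obtain ⟨Q, hQ⟩ := exists_polynomial_near_of_continuousOn 0 1 f hf (ε / 2) (by positivity)
  refine ⟨Q + Polynomial.C (f 0 - Q.eval 0) * (1 - Polynomial.X) +
    Polynomial.C (f 1 - Q.eval 1) * Polynomial.X, fun x hx => ?_, by simp, by simp⟩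
  have h0 := abs_lt.1 (hQ 0 (by simp))
  have h1 := abs_lt.1 (hQ 1 (by simp))
  have h2 := abs_lt.1 (hQ x hx)
  obtain ⟨hx0, hx1⟩ := hx
  simp only [Polynomial.eval_add, Polynomial.eval_mul, Polynomial.eval_C, Polynomial.eval_sub,
    Polynomial.eval_one, Polynomial.eval_X]
  rw [abs_lt]
  constructor <;> nlinarith

theorem exists_contDiff_near_eq_endpoints {f : I → ℂ} (hf : Continuous f) {ε : ℝ} (hε : 0 < ε) :
    ∃ q : ℝ → ℂ, ContDiff ℝ 1 q ∧ (∀ t : I, ‖q t - f t‖ < ε) ∧ q 0 = f 0 ∧ q 1 = f 1 := by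
  have key : ∀ g : I → ℝ, Continuous g → ∃ P : Polynomial ℝ,
      (∀ t : I, |P.eval (t : ℝ) - g t| < ε / 2) ∧ P.eval 0 = g 0 ∧ P.eval 1 = g 1 := by
    intro g hg
    obtain ⟨P, h1, h2, h3⟩ := exists_polynomial_near_eq_endpoints
      (f := Set.IccExtend zero_le_one g) hg.Icc_extend'.continuousOn (half_pos hε)
    refine ⟨P, fun t => ?_, ?_, ?_⟩
    · have := h1 t t.2
      rwa [Set.IccExtend_val] at this
    · rw [h2]; exact Set.IccExtend_left zero_le_one g
    · rw [h3]; exact Set.IccExtend_right zero_le_one g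
  obtain ⟨P, hP, hP0, hP1⟩ := key _ (Complex.continuous_re.comp hf)
  obtain ⟨Q, hQ, hQ0, hQ1⟩ := key _ (Complex.continuous_im.comp hf)
  refine ⟨fun t => ((P.eval t : ℝ) : ℂ) + ((Q.eval t : ℝ) : ℂ) * Complex.I, ?_, fun t => ?_, ?_, ?_⟩
  · exact (Complex.ofRealCLM.contDiff.comp (by simpa using P.contDiff_aeval (𝕜 := ℝ) 1)).add
      ((Complex.ofRealCLM.contDiff.comp (by simpa using Q.contDiff_aeval (𝕜 := ℝ) 1)).mul
        contDiff_const)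
  · refine (Complex.norm_le_abs_re_add_abs_im _).trans_lt ?_
    have h1 := hP t
    have h2 := hQ t
    simp only [Function.comp] at h1 h2
    simp
    linarith
  · simp only [hP0, hQ0]; exact Complex.re_add_im _
  · simp only [hP1, hQ1]; exact Complex.re_add_im _

variable {ι : Type*} [Fintype ι] [DecidableEq ι]

/-- A loop in the unit sphere of `ℂ^A`, `2 ≤ |A|`, is uniformly close to one missing a point. -/
theorem exists_unit_loop_avoiding {A : Finset ι} (hA : 2 ≤ A.card) {v : I → ι → ℂ}
    (hv : Continuous v) (hv1 : ∀ t, star (v t) ⬝ᵥ v t = 1) (hvA : ∀ t, ∀ i ∉ A, v t i = 0) :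
    ∃ (p : I → ι → ℂ) (u : ι → ℂ), Continuous p ∧ (∀ t, star (p t) ⬝ᵥ p t = 1) ∧
      (∀ t, ∀ i ∉ A, p t i = 0) ∧ p 0 = v 0 ∧ p 1 = v 1 ∧ (∀ t, p t ≠ -v t) ∧
      star u ⬝ᵥ u = 1 ∧ (∀ i ∉ A, u i = 0) ∧ ∀ t, p t ≠ u := by
  obtain ⟨ε, hε, hεA⟩ : ∃ ε : ℝ, 0 < ε ∧ ∀ w : ι → ℂ, (∀ i, ‖w i‖ < ε) → vecLength w < 1 := by
    have hc : ContinuousAt (vecLength : (ι → ℂ) → ℝ) 0 := continuous_vecLength.continuousAt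
    rw [Metric.continuousAt_iff] at hc
    obtain ⟨ε, hε, h⟩ := hc 1 one_pos
    refine ⟨ε, hε, fun w hw => ?_⟩
    have h0 : vecLength (0 : ι → ℂ) = 0 := by simp [vecLength]
    have := h (x := w) (by rw [dist_zero_right]; exact (pi_norm_lt_iff hε).2 hw)
    rw [h0, Real.dist_eq, sub_zero] at this
    exact (abs_lt.1 this).2
  choose q0 hqc hqε hq0 hq1 using fun i =>
    exists_contDiff_near_eq_endpoints ((continuous_apply i).comp hv) hε
  let q : ℝ → ι → ℂ := fun t i => if i ∈ A then q0 i t else 0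
  have hq : ContDiff ℝ 1 q := by
    rw [contDiff_pi]
    intro i
    by_cases h : i ∈ A
    · simpa [q, h] using hqc i
    · simpa [q, h] using contDiff_const
  have hqv : ∀ t : I, vecLength (q t - v t) < 1 := by
    intro t
    refine hεA _ fun i => ?_
    by_cases h : i ∈ A
    · simpa [q, h] using hqε i t
    · simpa [q, h, hvA t i h] using hε
  have hne : ∀ (t : I) (c : ℝ), 0 ≤ c → q t ≠ (-c) • v t := by
    intro t c hc h
    have h1 := hqv t
    have h2 : q t - v t = (-(c + 1)) • v t := by rw [h]; module
    rw [h2, vecLength_smul, vecLength_eq_one.2 (hv1 t), abs_neg, abs_of_nonneg (by linarith)] at h1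
    linarith
  have hq_ne : ∀ t : I, q t ≠ 0 := fun t => by simpa using hne t 0 le_rfl
  have hq0' : q 0 = v 0 := by
    funext i
    by_cases h : i ∈ A
    · simpa [q, h] using hq0 i
    · simp [q, h, hvA 0 i h]
  have hq1' : q 1 = v 1 := by
    funext i
    by_cases h : i ∈ A
    · simpa [q, h] using hq1 i
    · simp [q, h, hvA 1 i h]
  have hqA : ∀ t, ∀ i ∉ A, q t i = 0 := fun t i h => by simp [q, h]
  obtain ⟨w, hw⟩ : ∃ w : A → ℂ, w ∉ Set.range fun x : ℝ × ℝ => fun i : A => x.1 • q x.2 i := by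
    have hd : ContDiff ℝ 1 fun x : ℝ × ℝ => fun i : A => x.1 • q x.2 i := by
      rw [contDiff_pi]
      intro i
      exact contDiff_fst.smul ((contDiff_pi.1 hq i).comp contDiff_snd)
    refine (hd.dense_compl_range_of_finrank_lt_finrank ?_).nonempty
    rw [Module.finrank_prod, Module.finrank_self, Module.finrank_pi_fintype]
    simp only [Complex.finrank_real_complex, Finset.sum_const, Finset.card_univ, Fintype.card_coe,
      smul_eq_mul]
    omega
  let u0 : ι → ℂ := fun i => if h : i ∈ A then w ⟨i, h⟩ else 0
  have hu0 : u0 ≠ 0 := by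
    intro h
    refine hw ⟨(0, 0), funext fun i => ?_⟩
    have := congrFun h i.1
    simp only [u0, i.2, dif_pos] at this
    simp [this]
  refine ⟨fun t => unitVec (q t), unitVec u0, ?_, fun t => unitVec_unit (hq_ne t),
    fun t i hi => unitVec_apply_eq_zero (hqA t i hi), ?_, ?_, fun t h => ?_, unitVec_unit hu0,
    fun i hi => unitVec_apply_eq_zero (by simp [u0, hi]), fun t h => ?_⟩
  · exact continuous_unitVec (hq.continuous.comp continuous_subtype_val) hq_ne
  · simp only [Set.Icc.coe_zero, hq0', unitVec_of_unit (hv1 0)]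
  · simp only [Set.Icc.coe_one, hq1', unitVec_of_unit (hv1 1)]
  · refine hne t (vecLength (q t)) (vecLength_pos.2 (hq_ne t)).le ?_
    rw [neg_smul, ← smul_neg, ← h, smul_unitVec (hq_ne t)]
  · refine hw ⟨(vecLength u0 * (vecLength (q t))⁻¹, t), funext fun i => ?_⟩
    have h1 : u0 = (vecLength u0 * (vecLength (q t))⁻¹) • q t := by
      rw [mul_smul, ← unitVec, show unitVec (q t) = unitVec u0 from h, smul_unitVec hu0]
    have h2 := congrFun h1 i.1
    simp only [u0, i.2, dif_pos] at h2
    exact h2.symm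

end Approximation

section SpecialUnitary

variable {ι : Type*} [Fintype ι] [DecidableEq ι]

theorem unit_mulVec {M : unitaryGroup ι ℂ} {x : ι → ℂ} (hx : star x ⬝ᵥ x = 1) :
    star (M.1 *ᵥ x) ⬝ᵥ (M.1 *ᵥ x) = 1 := by
  rw [star_mulVec, dotProduct_mulVec, vecMul_vecMul, ← star_eq_conjTranspose,
    mem_unitaryGroup_iff'.1 M.2, vecMul_one, hx]

theorem inv_mulVec_eq {M : unitaryGroup ι ℂ} {x y : ι → ℂ} (h : M.1 *ᵥ x = y) :
    (M⁻¹).1 *ᵥ y = x := by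
  rw [← h, mulVec_mulVec, ← Submonoid.coe_mul, inv_mul_cancel]
  exact one_mulVec x

theorem mulVec_apply_eq_zero_of_mem {A : Finset ι} {M : unitaryGroup ι ℂ}
    (hM : M ∈ supportedUnitary A) {x : ι → ℂ} (hx : ∀ i ∉ A, x i = 0) {i : ι} (hi : i ∉ A) :
    (M.1 *ᵥ x) i = 0 := by
  rw [mulVec, dotProduct]
  refine Finset.sum_eq_zero fun j _ => ?_
  rw [supportedUnitary_apply_of_row hM hi]
  by_cases h : i = j
  · subst h; simp [hx i hi]
  · simp [h]

theorem exists_nullLoop_mulVec_eq {A : Finset ι} (hA : 2 ≤ A.card) {e : ι → ℂ} {v : I → ι → ℂ}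
    (he : star e ⬝ᵥ e = 1)
    (hv : Continuous v) (hv1 : ∀ t, star (v t) ⬝ᵥ v t = 1) (hvA : ∀ t, ∀ i ∉ A, v t i = 0)
    (h0 : v 0 = e) (h1 : v 1 = e) :
    ∃ α : I → unitaryGroup ι ℂ, NullLoop (supportedUnitary A) α ∧ ∀ t, (α t).1 *ᵥ e = v t := by
  obtain ⟨p, u, hp, hp1, hpA, hp_zero, hp_one, hpv, hu1, huA, hpu⟩ :=
    exists_unit_loop_avoiding hA hv hv1 hvA
  rw [h0] at hp_zero
  rw [h1] at hp_one
  have hvp : NullLoop (supportedUnitary A) fun t => rotateTo (v t) (p t) := by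
    let y : I × I → ι → ℂ := fun x =>
      unitVec ((1 - (σ x.1 : ℝ)) • v x.2 + (σ x.1 : ℝ) • p x.2)
    have hne : ∀ x : I × I, (1 - (σ x.1 : ℝ)) • v x.2 + (σ x.1 : ℝ) • p x.2 ≠ 0 := fun x =>
      segment_ne_zero (hv1 _) (hp1 _) (hpv _) (σ x.1).2.1 (σ x.1).2.2
    have hy : Continuous y := continuous_unitVec (by fun_prop) hne
    have hy1 : ∀ x, star (y x) ⬝ᵥ y x = 1 := fun x => unitVec_unit (hne x)
    have hyv : ∀ x, y x ≠ -v x.2 := fun x =>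
      unitVec_segment_ne_neg (hv1 _) (hp1 _) (hpv _) (σ x.1).2.1 (σ x.1).2.2
    refine ⟨fun x => rotateTo (v x.2) (y x), continuous_rotateTo (by fun_prop) hy
      (fun x => hv1 _) hy1 hyv, fun x => rotateTo_mem (hv1 _) (hy1 _) (hyv _) (hvA _)
      fun i hi => unitVec_apply_eq_zero (by simp [hvA _ i hi, hpA _ i hi]),
      fun t => ?_, fun t => ?_, fun s => ?_, fun s => ?_⟩
    · simp [y, unitVec_of_unit (hp1 t)]
    · simp [y, unitVec_of_unit (hv1 t), rotateTo_self (hv1 t)]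
    · have : y (s, 0) = v 0 := by
        simp only [y, hp_zero, h0]
        rw [← add_smul, sub_add_cancel, one_smul, unitVec_of_unit he]
      simp only [this, rotateTo_self (hv1 0)]
    · have : y (s, 1) = v 1 := by
        simp only [y, hp_one, h1]
        rw [← add_smul, sub_add_cancel, one_smul, unitVec_of_unit he]
      simp only [this, rotateTo_self (hv1 1)]
  have hue : u ≠ e := fun h => hpu 0 (by rw [hp_zero, h])
  have hpe : NullLoop (supportedUnitary A) fun t => reflectTo u (p t) * (reflectTo u e)⁻¹ := by
    have hnu1 : star (-u) ⬝ᵥ (-u) = 1 := by rwa [star_neg_dotProduct_neg]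
    have hup : ∀ t, -u ≠ -p t := fun t h => hpu t (neg_injective h).symm
    let y : I × I → ι → ℂ := fun x => unitVec ((1 - (x.1 : ℝ)) • p x.2 + (x.1 : ℝ) • (-u))
    have hne : ∀ x : I × I, (1 - (x.1 : ℝ)) • p x.2 + (x.1 : ℝ) • (-u) ≠ 0 := fun x =>
      segment_ne_zero (hp1 _) hnu1 (hup _) x.1.2.1 x.1.2.2
    have hy : Continuous y := continuous_unitVec (by fun_prop) hne
    have hy1 : ∀ x, star (y x) ⬝ᵥ y x = 1 := fun x => unitVec_unit (hne x)
    have hyu : ∀ x, u ≠ y x := fun x h => by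
      have h2 := unitVec_segment_ne_neg (x := -u) (y := p x.2) hnu1 (hp1 _)
        (by rw [neg_neg]; exact hpu _) (s := 1 - x.1) (by linarith [x.1.2.2])
        (by linarith [x.1.2.1])
      rw [sub_sub_cancel, neg_neg, add_comm] at h2
      exact h2 h.symm
    have hyA : ∀ x, ∀ i ∉ A, y x i = 0 := fun x i hi =>
      unitVec_apply_eq_zero (by simp [huA i hi, hpA _ i hi])
    have hend : ∀ s : I, ∀ t, p t = e → reflectTo u (y (s, t)) = reflectTo u (y (s, 0)) := by
      intro s t ht
      simp only [y, ht, hp_zero]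
    refine ⟨fun x => reflectTo u (y x) * (reflectTo u (y (x.1, 0)))⁻¹, ?_, fun x =>
      mul_mem (reflectTo_mem hu1 (hy1 _) (hyu _) huA (hyA _))
        (inv_mem (reflectTo_mem hu1 (hy1 _) (hyu _) huA (hyA _))),
      fun t => ?_, fun t => ?_, fun s => ?_, fun s => ?_⟩
    · have hc := continuous_reflectTo (continuous_const (y := u)) hy (fun _ => hu1) hy1 hyu
      exact hc.mul (hc.comp (by fun_prop : Continuous fun x : I × I => (x.1, (0 : I)))).inv
    · simp [y, unitVec_of_unit (hp1 _), hp_zero, unitVec_of_unit he]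
    · simp [y]
    · simp
    · simp only [hend s 1 hp_one, mul_inv_cancel]
  refine ⟨_, hvp.inv.mul hpe, fun t => ?_⟩
  rw [Submonoid.coe_mul, ← mulVec_mulVec, Submonoid.coe_mul, ← mulVec_mulVec,
    inv_mulVec_eq (reflectTo_mulVec hu1 he hue),
    reflectTo_mulVec hu1 (hp1 t) (hpu t).symm,
    inv_mulVec_eq (rotateTo_mulVec (hv1 t) (hp1 t) (hpv t))]

theorem supportedUnitary_eq_one {A : Finset ι} (hA : A.card ≤ 1) {M : unitaryGroup ι ℂ}
    (hM : M ∈ supportedUnitary A) (hdet : circleDet M = 1) : M = 1 := by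
  rcases Nat.le_one_iff_eq_zero_or_eq_one.1 hA with h | h
  · rw [Finset.card_eq_zero] at h
    subst h
    ext i j
    exact supportedUnitary_apply_of_col hM i (by simp)
  · obtain ⟨a, rfl⟩ := Finset.card_eq_one.1 h
    have hdiag : M.1 = diagonal (Function.update 1 a (M.1 a a)) := by
      ext i j
      by_cases hj : j = a
      · by_cases hi : i = a
        · subst hi; subst hj; simp
        · rw [supportedUnitary_apply_of_row hM (by simpa using hi)]
          simp [Matrix.one_apply, diagonal_apply, hi]
      · rw [supportedUnitary_apply_of_col hM i (by simpa using hj)]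
        by_cases hij : i = j
        · subst hij; simp [hj]
        · simp [hij]
    have h1 : M.1 a a = 1 := by
      have : M.1.det = 1 := by rw [← coe_circleDet, hdet]; rfl
      rw [hdiag, det_diagonal, Finset.prod_update_of_mem (Finset.mem_univ a)] at this
      simpa using this
    apply Subtype.ext
    rw [hdiag, h1]
    ext i j
    simp [diagonal_apply, Matrix.one_apply]

theorem nullLoop_of_det_eq_one (A : Finset ι) : ∀ γ : I → unitaryGroup ι ℂ, Continuous γ →
    (∀ t, γ t ∈ supportedUnitary A) → γ 0 = 1 → γ 1 = 1 → (∀ t, circleDet (γ t) = 1) →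
    NullLoop (supportedUnitary A) γ := by
  induction A using Finset.strongInduction with
  | H A ih =>
  intro γ hγ hγA h0 h1 hdet
  by_cases hA : A.card ≤ 1
  · have : γ = fun _ => 1 := funext fun t => supportedUnitary_eq_one hA (hγA t) (hdet t)
    rw [this]
    exact NullLoop.refl
  obtain ⟨a, ha, b, hb, hab⟩ := Finset.one_lt_card.1 (not_le.1 hA)
  have heA : ∀ i ∉ A, (Pi.single a 1 : ι → ℂ) i = 0 := fun i hi =>
    Pi.single_eq_of_ne (ne_of_mem_of_not_mem ha hi).symm 1
  have he : star (Pi.single a 1 : ι → ℂ) ⬝ᵥ Pi.single a 1 = 1 := by simp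
  obtain ⟨α, hα, hαe⟩ := exists_nullLoop_mulVec_eq (not_le.1 hA) (e := Pi.single a 1)
    (v := fun t => (γ t).1 *ᵥ Pi.single a 1) he
    ((continuous_subtype_val.comp hγ).matrix_mulVec continuous_const)
    (fun t => unit_mulVec he) (fun t i hi => mulVec_apply_eq_zero_of_mem (hγA t) heA hi)
    (by rw [h0]; exact one_mulVec _) (by rw [h1]; exact one_mulVec _)
  have hba : b ∈ A.erase a := Finset.mem_erase.2 ⟨hab.symm, hb⟩
  have hD : NullLoop (supportedUnitary A) fun t => diagAt b (circleDet (α t)) :=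
    hα.map (f := fun M => diagAt b (circleDet M)) ((continuous_diagAt b).comp continuous_circleDet)
      (by rw [map_one, diagAt_one]) fun M _ => diagAt_mem hb _
  have hη := ih _ (Finset.erase_ssubset ha)
    (fun t => diagAt b (circleDet (α t)) * ((α t)⁻¹ * γ t))
    (hD.continuous.mul (hα.continuous.inv.mul hγ))
    (fun t => mul_mem (diagAt_mem hba _) (supportedUnitary_erase
      (mul_mem (inv_mem (hα.mem t)) (hγA t)) (by
        rw [Submonoid.coe_mul, ← mulVec_mulVec, inv_mulVec_eq (hαe t)])))
    (by simp [h0, hα.zero, diagAt_one]) (by simp [h1, hα.one, diagAt_one])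
    (fun t => by simp [circleDet_diagAt, hdet])
  have := hα.mul (hD.inv.mul (hη.mono (supportedUnitary_mono (Finset.erase_subset a A))))
  convert this using 2 with t
  group

/-- A loop in the unitary group of `A` is null-homotopic if its determinant lifts to a loop. -/
theorem nullLoop_of_lift {A : Finset ι} {b : ι} (hb : b ∈ A) {γ : I → unitaryGroup ι ℂ}
    (hγ : Continuous γ) (hγA : ∀ t, γ t ∈ supportedUnitary A) (h0 : γ 0 = 1) (h1 : γ 1 = 1)
    {l : I → ℝ} (hl : Continuous l) (hl0 : l 0 = 0) (hl1 : l 1 = 0)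
    (hdet : ∀ t, circleDet (γ t) = Circle.exp (l t)) :
    NullLoop (supportedUnitary A) γ := by
  have hD : NullLoop (supportedUnitary A) fun t => diagAt b (Circle.exp (l t)) :=
    ⟨fun x => diagAt b (Circle.exp ((1 - (x.1 : ℝ)) * l x.2)),
      (continuous_diagAt b).comp (by fun_prop), fun _ => diagAt_mem hb _, by simp,
      by simp [diagAt_one], by simp [hl0, diagAt_one], by simp [hl1, diagAt_one]⟩
  have h := nullLoop_of_det_eq_one A (fun t => (diagAt b (Circle.exp (l t)))⁻¹ * γ t)
    (hD.continuous.inv.mul hγ) (fun t => mul_mem (inv_mem (diagAt_mem hb _)) (hγA t))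
    (by simp [h0, hl0, diagAt_one]) (by simp [h1, hl1, diagAt_one])
    (fun t => by simp [circleDet_diagAt, hdet])
  convert hD.mul h using 2 with t
  group

end SpecialUnitary

section Blocks

variable {n : ℕ}

/-- The unitary matrices which are block diagonal for the classes of `r`. -/
def blockUnitary (r : Setoid (Fin n)) : Subgroup (unitaryGroup (Fin n) ℂ) where
  carrier := {M | ∀ i j, ¬ r i j → M.1 i j = 0}
  one_mem' := fun i j h => Matrix.one_apply_ne fun hij => h (hij ▸ r.refl i)
  mul_mem' := fun {M N} hM hN i j h => by
    rw [Submonoid.coe_mul, mul_apply]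
    refine Finset.sum_eq_zero fun k _ => ?_
    by_cases hik : r i k
    · rw [hN k j fun hkj => h (r.trans hik hkj), mul_zero]
    · rw [hM i k hik, zero_mul]
  inv_mem' := fun {M} hM i j h => by
    rw [coe_inv_unitary, conjTranspose_apply, hM j i fun hji => h (r.symm hji), star_zero]

theorem IsBlock.mem_iff {r : Setoid (Fin n)} {B : Finset (Fin n)} (hB : IsBlock r B) {i j : Fin n}
    (hi : i ∈ B) : j ∈ B ↔ r i j := by
  obtain ⟨k, hk⟩ := hB
  have hki := (hk i).1 hi
  rw [hk]
  exact ⟨fun h => r.trans (r.symm hki) h, fun h => r.trans hki h⟩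

theorem IsBlock.nonempty {r : Setoid (Fin n)} {B : Finset (Fin n)} (hB : IsBlock r B) :
    B.Nonempty := by
  obtain ⟨k, hk⟩ := hB
  exact ⟨k, (hk k).2 (r.refl k)⟩

/-- The matrix agreeing with `M` on `B × B` and with the identity elsewhere. -/
def blockRestrict (B : Finset (Fin n)) (M : Matrix (Fin n) (Fin n) ℂ) :
    Matrix (Fin n) (Fin n) ℂ :=
  of fun i j => if i ∈ B ∧ j ∈ B then M i j else (1 : Matrix (Fin n) (Fin n) ℂ) i j

theorem blockRestrict_one (B : Finset (Fin n)) : blockRestrict B 1 = 1 := by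
  ext i j
  simp [blockRestrict]

theorem blockRestrict_mul {r : Setoid (Fin n)} {B : Finset (Fin n)} (hB : IsBlock r B)
    {M N : Matrix (Fin n) (Fin n) ℂ} (hM : ∀ i j, ¬ r i j → M i j = 0) :
    blockRestrict B M * blockRestrict B N = blockRestrict B (M * N) := by
  ext i j
  rw [mul_apply]
  by_cases hi : i ∈ B
  · by_cases hj : j ∈ B
    · have : blockRestrict B (M * N) i j = ∑ k, M i k * N k j := by
        simp [blockRestrict, hi, hj, mul_apply]
      rw [this]
      refine Finset.sum_congr rfl fun k _ => ?_
      by_cases hk : k ∈ B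
      · simp [blockRestrict, hi, hj, hk]
      · have hik : i ≠ k := ne_of_mem_of_not_mem hi hk
        simp [blockRestrict, hk, hM i k fun h => hk ((hB.mem_iff hi).2 h), hik]
    · have hij : i ≠ j := ne_of_mem_of_not_mem hi hj
      simp [blockRestrict, hj, Matrix.one_apply, hij]
  · have hrow : ∀ N k, blockRestrict B N i k = (1 : Matrix (Fin n) (Fin n) ℂ) i k := fun N k => by
      simp [blockRestrict, hi]
    simp only [hrow, Matrix.one_apply, ite_mul, one_mul, zero_mul, Finset.sum_ite_eq,
      Finset.mem_univ, if_true]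

theorem star_blockRestrict (B : Finset (Fin n)) (M : Matrix (Fin n) (Fin n) ℂ) :
    star (blockRestrict B M) = blockRestrict B (star M) := by
  ext i j
  rw [star_apply]
  simp only [blockRestrict, of_apply, and_comm (a := j ∈ B), star_apply, Matrix.one_apply,
    eq_comm (a := j)]
  split_ifs <;> simp

theorem det_blockRestrict (B : Finset (Fin n)) (M : Matrix (Fin n) (Fin n) ℂ) :
    (blockRestrict B M).det = blockDet B M := by
  rw [twoBlockTriangular_det _ (· ∈ B)]
  · have h1 : (blockRestrict B M).toSquareBlockProp (· ∈ B) =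
        M.submatrix (fun i : {x // x ∈ B} => i.1) (fun j : {x // x ∈ B} => j.1) := by
      ext i j
      simp [blockRestrict, toSquareBlockProp, i.2, j.2]
    have h2 : (blockRestrict B M).toSquareBlockProp (fun i => ¬ i ∈ B) = 1 := by
      ext i j
      simp [blockRestrict, toSquareBlockProp, i.2, Matrix.one_apply, Subtype.ext_iff]
    rw [h1, h2, det_one, mul_one]
    unfold blockDet
    congr!
  · intro i hi j hj
    simp [blockRestrict, hi, (ne_of_mem_of_not_mem hj hi).symm]

theorem blockRestrict_mem {r : Setoid (Fin n)} {B : Finset (Fin n)} (hB : IsBlock r B)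
    {M : unitaryGroup (Fin n) ℂ} (hM : M ∈ blockUnitary r) :
    blockRestrict B M.1 ∈ unitaryGroup (Fin n) ℂ := by
  rw [mem_unitaryGroup_iff, star_blockRestrict, blockRestrict_mul hB hM,
    mem_unitaryGroup_iff.1 M.2, blockRestrict_one]

/-- The restriction of a block diagonal unitary matrix to a block. -/
noncomputable def unitaryRestrict (B : Finset (Fin n)) (M : unitaryGroup (Fin n) ℂ) :
    unitaryGroup (Fin n) ℂ := toUnitary (blockRestrict B M.1)

theorem coe_unitaryRestrict {r : Setoid (Fin n)} {B : Finset (Fin n)} (hB : IsBlock r B)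
    {M : unitaryGroup (Fin n) ℂ} (hM : M ∈ blockUnitary r) :
    (unitaryRestrict B M).1 = blockRestrict B M.1 :=
  coe_toUnitary (blockRestrict_mem hB hM)

theorem unitaryRestrict_mul {r : Setoid (Fin n)} {B : Finset (Fin n)} (hB : IsBlock r B)
    {M N : unitaryGroup (Fin n) ℂ} (hM : M ∈ blockUnitary r) (hN : N ∈ blockUnitary r) :
    unitaryRestrict B (M * N) = unitaryRestrict B M * unitaryRestrict B N := by
  apply Subtype.ext
  rw [Submonoid.coe_mul, coe_unitaryRestrict hB hM, coe_unitaryRestrict hB hN,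
    coe_unitaryRestrict hB (mul_mem hM hN), blockRestrict_mul hB hM, Submonoid.coe_mul]

theorem coe_circleDet_unitaryRestrict {r : Setoid (Fin n)} {B : Finset (Fin n)} (hB : IsBlock r B)
    {M : unitaryGroup (Fin n) ℂ} (hM : M ∈ blockUnitary r) :
    (circleDet (unitaryRestrict B M) : ℂ) = blockDet B M.1 := by
  rw [coe_circleDet, coe_unitaryRestrict hB hM, det_blockRestrict]

theorem unitaryRestrict_mem_supportedUnitary {r : Setoid (Fin n)} {B : Finset (Fin n)}
    (hB : IsBlock r B) {M : unitaryGroup (Fin n) ℂ} (hM : M ∈ blockUnitary r) :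
    unitaryRestrict B M ∈ supportedUnitary B := by
  intro j hj
  rw [coe_unitaryRestrict hB hM, mulVec_single_one]
  funext i
  simp [blockRestrict, hj, Matrix.one_apply, Pi.single_apply]

theorem unitaryRestrict_one (B : Finset (Fin n)) : unitaryRestrict B 1 = 1 := by
  rw [unitaryRestrict, OneMemClass.coe_one, blockRestrict_one, toUnitary_one]

theorem unitaryRestrict_inv {r : Setoid (Fin n)} {B : Finset (Fin n)} (hB : IsBlock r B)
    {M : unitaryGroup (Fin n) ℂ} (hM : M ∈ blockUnitary r) :
    unitaryRestrict B M⁻¹ = (unitaryRestrict B M)⁻¹ := by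
  rw [eq_inv_iff_mul_eq_one, ← unitaryRestrict_mul hB (inv_mem hM) hM, inv_mul_cancel,
    unitaryRestrict_one]

theorem continuous_blockRestrict (B : Finset (Fin n)) : Continuous (blockRestrict B) := by
  refine continuous_matrix fun i j => ?_
  by_cases h : i ∈ B ∧ j ∈ B
  · simpa [blockRestrict, h] using continuous_id.matrix_elem i j
  · simpa only [blockRestrict, of_apply, h, if_false] using continuous_const

theorem continuous_unitaryRestrict {X : Type*} [TopologicalSpace X] {r : Setoid (Fin n)}
    {B : Finset (Fin n)} (hB : IsBlock r B) {M : X → unitaryGroup (Fin n) ℂ} (hM : Continuous M)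
    (h : ∀ x, M x ∈ blockUnitary r) : Continuous fun x => unitaryRestrict B (M x) :=
  continuous_toUnitary ((continuous_blockRestrict B).comp (continuous_subtype_val.comp hM))
    fun x => blockRestrict_mem hB (h x)

/-- A loop of block diagonal unitary matrices is null-homotopic if all its block determinants
lift to loops. -/
theorem nullLoop_blockUnitary {r : Setoid (Fin n)} {γ : I → unitaryGroup (Fin n) ℂ}
    (hγ : Continuous γ) (hγr : ∀ t, γ t ∈ blockUnitary r) (h0 : γ 0 = 1) (h1 : γ 1 = 1)
    (hl : ∀ B, IsBlock r B → ∃ l : I → ℝ, Continuous l ∧ l 0 = 0 ∧ l 1 = 0 ∧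
      ∀ t, circleDet (unitaryRestrict B (γ t)) = Circle.exp (l t)) :
    NullLoop (blockUnitary r) γ := by
  classical
  have key : ∀ B, ∃ K : I × I → unitaryGroup (Fin n) ℂ, IsBlock r B →
      Continuous K ∧ (∀ p, K p ∈ supportedUnitary B) ∧
      (∀ t, K (0, t) = unitaryRestrict B (γ t)) ∧ (∀ t, K (1, t) = 1) ∧
      (∀ s, K (s, 0) = 1) ∧ ∀ s, K (s, 1) = 1 := by
    intro B
    by_cases hB : IsBlock r B
    · obtain ⟨l, hlc, hl0, hl1, hlγ⟩ := hl B hB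
      obtain ⟨b, hb⟩ := hB.nonempty
      obtain ⟨K, hK⟩ := nullLoop_of_lift hb (continuous_unitaryRestrict hB hγ hγr)
        (fun t => unitaryRestrict_mem_supportedUnitary hB (hγr t))
        (by rw [h0, unitaryRestrict_one]) (by rw [h1, unitaryRestrict_one]) hlc hl0 hl1 hlγ
      exact ⟨K, fun _ => hK⟩
    · exact ⟨fun _ => 1, fun h => absurd h hB⟩
  choose K hK using key
  let cls : Fin n → Finset (Fin n) := fun i => Finset.univ.filter (r i)
  have hmem : ∀ i j, j ∈ cls i ↔ r i j := fun i j => by simp [cls]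
  have hcls : ∀ i, IsBlock r (cls i) := fun i => ⟨i, hmem i⟩
  have hcls_eq : ∀ i j, r i j → cls i = cls j := fun i j h => by
    ext k
    rw [hmem, hmem]
    exact ⟨fun h' => r.trans (r.symm h) h', fun h' => r.trans h h'⟩
  let L : I × I → Matrix (Fin n) (Fin n) ℂ := fun p =>
    of fun i j => if r i j then (K (cls i) p).1 i j else 0
  have hLu : ∀ p, L p ∈ unitaryGroup (Fin n) ℂ := by
    intro p
    rw [mem_unitaryGroup_iff]
    ext i j
    have hrow : ∀ i k, L p i k = if r i k then (K (cls i) p).1 i k else 0 := fun i k => rfl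
    rw [mul_apply]
    by_cases hij : r i j
    · have := congrFun (congrFun (mem_unitaryGroup_iff.1 (K (cls i) p).2) i) j
      rw [mul_apply] at this
      rw [← this]
      refine Finset.sum_congr rfl fun k _ => ?_
      rw [star_apply, star_apply, hrow, hrow, ← hcls_eq i j hij]
      by_cases hik : r i k
      · rw [if_pos hik, if_pos (r.trans (r.symm hij) hik)]
      · have hk : k ∉ cls i := fun h => hik ((hmem i k).1 h)
        have hik' : i ≠ k := fun h => hik (by rw [h])
        rw [if_neg hik, supportedUnitary_apply_of_col ((hK _ (hcls i)).2.1 p) i hk,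
          Matrix.one_apply_ne hik', zero_mul, zero_mul]
    · rw [Matrix.one_apply_ne (fun h => hij (by rw [h]) : i ≠ j)]
      refine Finset.sum_eq_zero fun k _ => ?_
      rw [star_apply, hrow, hrow]
      by_cases hik : r i k
      · rw [if_neg fun h => hij (r.trans hik (r.symm h)), star_zero, mul_zero]
      · rw [if_neg hik, zero_mul]
  have hL1 : ∀ p, (∀ i, K (cls i) p = 1) → toUnitary (L p) = 1 := by
    intro p hp
    rw [← toUnitary_one]
    congr 1
    ext i j
    simp only [L, of_apply, hp]
    by_cases hij : r i j
    · simp [hij]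
    · simp [hij, Matrix.one_apply_ne fun h : i = j => hij (h ▸ r.refl i)]
  refine ⟨fun p => toUnitary (L p), continuous_toUnitary ?_ hLu, fun p i j hij => ?_, fun t => ?_,
    fun t => hL1 _ fun i => (hK _ (hcls i)).2.2.2.1 t,
    fun s => hL1 _ fun i => (hK _ (hcls i)).2.2.2.2.1 s,
    fun s => hL1 _ fun i => (hK _ (hcls i)).2.2.2.2.2 s⟩
  · refine continuous_matrix fun i j => ?_
    by_cases hij : r i j
    · simpa [L, hij] using (continuous_subtype_val.comp (hK _ (hcls i)).1).matrix_elem i j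
    · simpa [L, hij] using continuous_const
  · rw [coe_toUnitary (hLu p)]
    simp [L, hij]
  · apply Subtype.ext
    rw [coe_toUnitary (hLu _)]
    ext i j
    by_cases hij : r i j
    · simp [L, hij, (hK _ (hcls i)).2.2.1 t, coe_unitaryRestrict (hcls i) (hγr t), blockRestrict,
        (hmem i j).2 hij, (hmem i i).2 (r.refl i)]
    · simp [L, hij, hγr t i j hij]

end Blocks

section PermutationPaths

variable {n : ℕ}

theorem permMat_apply (g : Equiv.Perm (Fin n)) (i j : Fin n) :
    permMat g i j = if i = g j then 1 else 0 := rfl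

theorem permMat_mul (g h : Equiv.Perm (Fin n)) : permMat (g * h) = permMat g * permMat h := by
  ext i j
  simp [mul_apply, permMat_apply]
  congr

theorem permMat_one : permMat (1 : Equiv.Perm (Fin n)) = 1 := by
  ext i j
  rw [permMat_apply, Matrix.one_apply]
  rfl

theorem star_permMat (g : Equiv.Perm (Fin n)) : star (permMat g) = permMat g⁻¹ := by
  ext i j
  rw [star_apply, permMat_apply, permMat_apply]
  by_cases h : j = g i
  · simp [h]
  · rw [if_neg h, if_neg fun h' => h (by
      rw [h', ← Equiv.Perm.mul_apply, mul_inv_cancel, Equiv.Perm.one_apply]), star_zero]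

/-- Permutation matrices as unitary matrices. -/
def permUnitary : Equiv.Perm (Fin n) →* unitaryGroup (Fin n) ℂ where
  toFun g := ⟨permMat g, by
    rw [mem_unitaryGroup_iff, star_permMat, ← permMat_mul, mul_inv_cancel, permMat_one]⟩
  map_one' := Subtype.ext permMat_one
  map_mul' g h := Subtype.ext (permMat_mul g h)

theorem coe_permUnitary (g : Equiv.Perm (Fin n)) : (permUnitary g).1 = permMat g := rfl

theorem exists_path_swap {r : Setoid (Fin n)} {i j : Fin n} (hij : r i j) :
    ∃ α : I → unitaryGroup (Fin n) ℂ, Continuous α ∧ (∀ t, α t ∈ blockUnitary r) ∧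
      α 0 = 1 ∧ α 1 = permUnitary (Equiv.swap i j) := by
  by_cases hne : i = j
  · subst hne
    exact ⟨fun _ => 1, continuous_const, fun _ => one_mem _, rfl, by
      rw [Equiv.swap_self, ← Equiv.Perm.one_def, map_one]⟩
  let w : Fin n → ℂ := Pi.single i 1 - Pi.single j 1
  let P : Matrix (Fin n) (Fin n) ℂ := vecMulVec w w
  have hww : w ⬝ᵥ w = 2 := by
    simp [w, hne, Ne.symm hne]
    norm_num
  have hPP : P * P = (2 : ℂ) • P := by
    simp only [P, vecMulVec_mul_vecMulVec, hww]
    ext a b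
    simp [vecMulVec_apply]
    ring
  have hsw : star w = w := by
    funext a
    simp [w, Pi.single_apply]
  have hP : star P = P := by
    rw [star_eq_conjTranspose, conjTranspose_vecMulVec, hsw]
  let c : I → ℂ := fun t => (1 - Circle.exp (Real.pi * (t : ℝ))) / 2
  let T : I → Matrix (Fin n) (Fin n) ℂ := fun t => 1 - c t • P
  have hcc : ∀ t, c t + star (c t) = 2 * (c t * star (c t)) := by
    intro t
    have h1 : (Circle.exp (Real.pi * (t : ℝ)) : ℂ) *
        star (Circle.exp (Real.pi * (t : ℝ)) : ℂ) = 1 := by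
      have := Complex.mul_conj (Circle.exp (Real.pi * (t : ℝ)) : ℂ)
      rw [Circle.normSq_coe] at this
      simpa using this
    simp only [c, star_div₀, star_sub, star_one, star_ofNat]
    linear_combination (-1 / 2 : ℂ) * h1
  have hT : ∀ t, T t ∈ unitaryGroup (Fin n) ℂ := by
    intro t
    rw [mem_unitaryGroup_iff]
    have : T t * star (T t) = 1 - (c t + star (c t) - 2 * (c t * star (c t))) • P := by
      simp only [T, star_sub, star_one, star_smul, hP, sub_mul, mul_sub, one_mul, mul_one,
        smul_mul_smul_comm, hPP]
      module
    rw [this, hcc, sub_self, zero_smul, sub_zero]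
  have hcont : Continuous T := by
    have : Continuous c := by
      have : Continuous fun t : I => Circle.exp (Real.pi * (t : ℝ)) := by fun_prop
      have : Continuous fun t : I => (Circle.exp (Real.pi * (t : ℝ)) : ℂ) :=
        continuous_subtype_val.comp this
      fun_prop
    fun_prop
  refine ⟨fun t => toUnitary (T t), continuous_toUnitary hcont hT, fun t a b hab => ?_, ?_, ?_⟩
  · rw [coe_toUnitary (hT t)]
    have h1 : a ≠ b := by rintro rfl; exact hab (r.refl _)
    have h2 : w a * w b = 0 := by
      simp only [w, Pi.sub_apply, Pi.single_apply]
      split_ifs <;> simp_all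
      · exact (hab (r.symm hij)).elim
    simp [T, h1, P, vecMulVec_apply, h2]
  · rw [← toUnitary_one]
    simp [T, c]
  · apply Subtype.ext
    rw [coe_toUnitary (hT 1), coe_permUnitary]
    have hc : c 1 = 1 := by
      simp [c]
    have hTab : ∀ a b, T 1 a b = (if a = b then 1 else 0) - ((if a = i then 1 else 0) -
        (if a = j then 1 else 0)) * ((if b = i then 1 else 0) - (if b = j then 1 else 0)) := by
      intro a b
      simp [T, hc, P, vecMulVec_apply, w, Pi.single_apply, Matrix.one_apply]
    ext a b
    rw [hTab, permMat_apply, Equiv.swap_apply_def]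
    by_cases hbi : b = i
    · subst hbi
      by_cases haj : a = j
      · subst haj; simp [hne, Ne.symm hne]
      · by_cases hab : a = b <;> simp [haj, hab, hne]
    · by_cases hbj : b = j
      · subst hbj
        by_cases hai : a = i
        · subst hai; simp [hne, Ne.symm hne]
        · by_cases hab : a = b <;> simp [hai, hab, Ne.symm hne]
      · simp [hbi, hbj]

theorem exists_path_perm {r : Setoid (Fin n)} (g : Equiv.Perm (Fin n)) (hg : ∀ i, r i (g i)) :
    ∃ α : I → unitaryGroup (Fin n) ℂ, Continuous α ∧ (∀ t, α t ∈ blockUnitary r) ∧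
      α 0 = 1 ∧ α 1 = permUnitary g := by
  induction hk : g.support.card using Nat.strong_induction_on generalizing g with
  | _ k ih =>
    by_cases h : ∃ x, g x ≠ x
    · obtain ⟨x, hx⟩ := h
      have hlt := Equiv.Perm.card_support_swap_mul hx
      obtain ⟨β, b1, b2, b3, b4⟩ := ih _ (hk ▸ hlt) (Equiv.swap x (g x) * g) (fun i => by
        rw [Equiv.Perm.mul_apply, Equiv.swap_apply_def]
        split_ifs with h1 h2
        · exact r.trans (h1 ▸ hg i) (hg x)
        · rw [g.injective h2]
        · exact hg i) rfl
      obtain ⟨α, a1, a2, a3, a4⟩ := exists_path_swap (hg x)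
      refine ⟨fun t => α t * β t, a1.mul b1, fun t => mul_mem (a2 t) (b2 t), by simp [a3, b3], ?_⟩
      simp only [a4, b4]
      rw [← map_mul, ← mul_assoc, Equiv.swap_mul_self, one_mul]
    · push Not at h
      have : g = 1 := Equiv.ext h
      exact ⟨fun _ => 1, continuous_const, fun _ => one_mem _, rfl, by rw [this, map_one]⟩

end PermutationPaths

section Lifts

theorem exists_lift {E : Type*} [NormedAddCommGroup E] [NormedSpace ℝ E] {f : E → Circle}
    (hf : Continuous f) :
    ∃ l : E → ℝ, Continuous l ∧ ∀ x, f x = Circle.exp (2 * Real.pi * l x) := by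
  obtain ⟨a, ha⟩ := Circle.exp_surjective (f 0)
  obtain ⟨F, ⟨-, hF⟩, -⟩ := Circle.isCoveringMap_exp.existsUnique_continuousMap_lifts ⟨f, hf⟩
    (a₀ := 0) (e₀ := a) ha
  refine ⟨fun x => F x / (2 * Real.pi), by fun_prop, fun x => ?_⟩
  rw [mul_div_cancel₀ _ Real.two_pi_pos.ne']
  exact (congrFun hF x).symm

theorem lift_sub_eq_sub {X : Type*} [TopologicalSpace X] {s : Set X} (hs : IsPreconnected s)
    {l l' : X → ℝ} (hl : ContinuousOn l s) (hl' : ContinuousOn l' s)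
    (h : ∀ x ∈ s, Circle.exp (2 * Real.pi * l x) = Circle.exp (2 * Real.pi * l' x)) {x y : X}
    (hx : x ∈ s) (hy : y ∈ s) : l y - l x = l' y - l' x := by
  have key : ∀ x ∈ s, ∃ m : ℤ, l x - l' x = m := fun x hx => by
    obtain ⟨m, hm⟩ := Circle.exp_eq_exp.1 (h x hx)
    refine ⟨m, mul_left_cancel₀ Real.two_pi_pos.ne' ?_⟩
    linear_combination hm
  have : (fun x => l x - l' x) x = (fun x => l x - l' x) y := by
    refine hs.constant_of_mapsTo (T := Set.range ((↑) : ℤ → ℝ))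
      Int.isClosedEmbedding_coe_real.isInducing.isDiscrete_range (hl.sub hl') ?_ hx hy
    intro x hx
    obtain ⟨m, hm⟩ := key x hx
    exact ⟨m, hm.symm⟩
  linarith

end Lifts

section Skeleton

variable {n : ℕ}

/-- The partition into orbits of a permutation group, as an equivalence relation. -/
def orbitSetoid (G : Subgroup (Equiv.Perm (Fin n))) : Setoid (Fin n) where
  r := sameOrbit G
  iseqv :=
    { refl := fun i => ⟨1, one_mem G, rfl⟩
      symm := fun {i j} ⟨p, hp, h⟩ => ⟨p⁻¹, inv_mem hp, by
        rw [← h, ← Equiv.Perm.mul_apply, inv_mul_cancel, Equiv.Perm.one_apply]⟩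
      trans := fun {i j k} ⟨p, hp, h⟩ ⟨q, hq, h'⟩ => ⟨q * p, mul_mem hq hp, by
        rw [Equiv.Perm.mul_apply, h, h']⟩ }

/-- The orbit equivalence relation attached to an edge. -/
abbrev edgeSetoid (g0 g1 : Equiv.Perm (Fin n)) : Setoid (Fin n) := orbitSetoid (groupOf {g0, g1})

theorem edgeSetoid_apply (g0 g1 : Equiv.Perm (Fin n)) (i : Fin n) :
    edgeSetoid g0 g1 i ((g0⁻¹ * g1) i) :=
  ⟨g0⁻¹ * g1, Subgroup.subset_closure ⟨g0, by simp, g1, by simp, rfl⟩, rfl⟩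

theorem edgePt_zero (g0 g1 : Equiv.Perm (Fin n)) : edgePt g0 g1 0 = vertex g0 := by
  funext h
  simp [edgePt, vertex]

theorem edgePt_one (g0 g1 : Equiv.Perm (Fin n)) : edgePt g0 g1 1 = vertex g1 := by
  funext h
  simp [edgePt, vertex]

theorem edgePt_left {g0 g1 : Equiv.Perm (Fin n)} (h : g0 ≠ g1) (t : ℝ) :
    edgePt g0 g1 t g0 = 1 - t := by
  simp [edgePt, h]

theorem edgePt_right {g0 g1 : Equiv.Perm (Fin n)} (h : g0 ≠ g1) (t : ℝ) :
    edgePt g0 g1 t g1 = t := by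
  simp [edgePt, h.symm]

theorem edgePt_of_ne {g0 g1 h : Equiv.Perm (Fin n)} (h0 : h ≠ g0) (h1 : h ≠ g1) (t : ℝ) :
    edgePt g0 g1 t h = 0 := by
  simp [edgePt, h0, h1]

theorem vertex_self (g : Equiv.Perm (Fin n)) : vertex g g = 1 := by
  simp [vertex]

theorem vertex_of_ne {g h : Equiv.Perm (Fin n)} (hne : h ≠ g) : vertex g h = 0 := by
  simp [vertex, hne]

/-- The closed edge spanned by two (possibly equal) vertices. -/
def edgeSet (g0 g1 : Equiv.Perm (Fin n)) : Set (Equiv.Perm (Fin n) → ℝ) :=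
  {x | (∀ g, 0 ≤ x g) ∧ (∑ g, x g) = 1 ∧ ∀ h, h ≠ g0 → h ≠ g1 → x h = 0}

theorem isClosed_edgeSet (g0 g1 : Equiv.Perm (Fin n)) : IsClosed (edgeSet g0 g1) := by
  simp only [edgeSet, Set.ofPred_and, Set.ofPred_forall]
  refine IsClosed.inter (isClosed_iInter fun g => isClosed_le continuous_const
    (continuous_apply g)) (IsClosed.inter (isClosed_eq (by fun_prop) continuous_const) ?_)
  exact isClosed_iInter fun h => isClosed_iInter fun _ => isClosed_iInter fun _ =>
    isClosed_eq (continuous_apply h) continuous_const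

theorem edgeSet_subset_skel (g0 g1 : Equiv.Perm (Fin n)) : edgeSet g0 g1 ⊆ skel n 1 := by
  rintro x ⟨h1, h2, h3⟩
  refine ⟨h1, h2, (Finset.card_le_card (t := {g0, g1}) fun h hh => ?_).trans Finset.card_le_two⟩
  rw [Finset.mem_filter] at hh
  by_contra hne
  simp only [Finset.mem_insert, Finset.mem_singleton, not_or] at hne
  exact hh.2 (h3 h hne.1 hne.2)

theorem edgePt_mem_edgeSet (g0 g1 : Equiv.Perm (Fin n)) (t : I) :
    edgePt g0 g1 t ∈ edgeSet g0 g1 := by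
  refine ⟨fun g => ?_, ?_, fun h h0 h1 => edgePt_of_ne h0 h1 t⟩
  · have h0 := t.2.1
    have h1 := t.2.2
    simp only [edgePt]
    split_ifs <;> linarith
  · simp [edgePt, Finset.sum_add_distrib]

theorem eq_vertex_of_mem_edgeSet {g : Equiv.Perm (Fin n)} {x : Equiv.Perm (Fin n) → ℝ}
    (hx : x ∈ edgeSet g g) : x = vertex g := by
  obtain ⟨-, h2, h3⟩ := hx
  rw [Finset.sum_eq_single g (fun h _ hh => h3 h hh hh) (by simp)] at h2
  funext h
  by_cases hh : h = g
  · rw [hh, h2, vertex_self]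
  · rw [h3 h hh hh, vertex_of_ne hh]

theorem exists_eq_edgePt {g0 g1 : Equiv.Perm (Fin n)} (hne : g0 ≠ g1)
    {x : Equiv.Perm (Fin n) → ℝ} (hx : x ∈ edgeSet g0 g1) : ∃ t : I, x = edgePt g0 g1 t := by
  obtain ⟨h1, h2, h3⟩ := hx
  have h4 : x g0 + x g1 = 1 := by
    rw [← Finset.sum_pair hne, ← h2]
    refine Finset.sum_subset (Finset.subset_univ _) fun h _ hh => ?_
    simp only [Finset.mem_insert, Finset.mem_singleton, not_or] at hh
    exact h3 h hh.1 hh.2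
  refine ⟨⟨x g1, h1 g1, by linarith [h1 g0]⟩, ?_⟩
  funext h
  by_cases hh0 : h = g0
  · subst hh0
    rw [edgePt_left hne]
    linarith
  · by_cases hh1 : h = g1
    · subst hh1
      rw [edgePt_right hne]
    · rw [h3 h hh0 hh1, edgePt_of_ne hh0 hh1]

theorem exists_mem_edgeSet [LinearOrder (Equiv.Perm (Fin n))] {x : Equiv.Perm (Fin n) → ℝ}
    (hx : x ∈ skel n 1) : ∃ g0 g1 : Equiv.Perm (Fin n), g0 ≤ g1 ∧ x ∈ edgeSet g0 g1 := by
  obtain ⟨h1, h2, h3⟩ := hx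
  have hne : (Finset.univ.filter fun g => x g ≠ 0).Nonempty := by
    by_contra hemp
    rw [Finset.not_nonempty_iff_eq_empty, Finset.filter_eq_empty_iff] at hemp
    rw [Finset.sum_eq_zero fun g hg => not_not.1 (hemp hg)] at h2
    exact zero_ne_one h2
  obtain ⟨a, b, hab⟩ : ∃ a b, ∀ g, x g ≠ 0 → g = a ∨ g = b := by
    have h4 := hne.card_pos
    obtain h | h : (Finset.univ.filter fun g => x g ≠ 0).card = 1 ∨
        (Finset.univ.filter fun g => x g ≠ 0).card = 2 := by omega
    · obtain ⟨a, ha⟩ := Finset.card_eq_one.1 h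
      refine ⟨a, a, fun g hg => ?_⟩
      have : g ∈ (Finset.univ.filter fun g => x g ≠ 0) := by simpa using hg
      simpa [ha] using this
    · obtain ⟨a, b, -, hab⟩ := Finset.card_eq_two.1 h
      refine ⟨a, b, fun g hg => ?_⟩
      have : g ∈ (Finset.univ.filter fun g => x g ≠ 0) := by simpa using hg
      simpa [hab] using this
  rcases le_total a b with h | h
  · exact ⟨a, b, h, h1, h2, fun g ha hb => by_contra fun hg => (hab g hg).elim ha hb⟩
  · exact ⟨b, a, h, h1, h2, fun g hb ha => by_contra fun hg => (hab g hg).elim ha hb⟩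

/-- Every point of the `1`-skeleton is a vertex or lies on an edge. -/
theorem eq_vertex_or_eq_edgePt [LinearOrder (Equiv.Perm (Fin n))] {x : Equiv.Perm (Fin n) → ℝ}
    (hx : x ∈ skel n 1) : (∃ g, x = vertex g) ∨ ∃ g0 g1, g0 < g1 ∧ ∃ t : I, x = edgePt g0 g1 t := by
  obtain ⟨g0, g1, hle, hx⟩ := exists_mem_edgeSet hx
  rcases hle.eq_or_lt with rfl | hlt
  · exact .inl ⟨g0, eq_vertex_of_mem_edgeSet hx⟩
  · exact .inr ⟨g0, g1, hlt, exists_eq_edgePt hlt.ne hx⟩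

theorem permMat_mul_apply (g : Equiv.Perm (Fin n)) (M : Matrix (Fin n) (Fin n) ℂ)
    (i j : Fin n) : (permMat g * M) i j = M (g⁻¹ i) j := by
  rw [mul_apply, Finset.sum_eq_single (g⁻¹ i)]
  · rw [permMat_apply, ← Equiv.Perm.mul_apply, mul_inv_cancel, Equiv.Perm.one_apply, if_pos rfl,
      one_mul]
  · intro k _ hk
    rw [permMat_apply, if_neg, zero_mul]
    rintro rfl
    rw [← Equiv.Perm.mul_apply, inv_mul_cancel, Equiv.Perm.one_apply] at hk
    exact hk rfl
  · simp

theorem admissible_of_edges [LinearOrder (Equiv.Perm (Fin n))]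
    {u : (Equiv.Perm (Fin n) → ℝ) → Matrix (Fin n) (Fin n) ℂ} (hc : ContinuousOn u (skel n 1))
    (hv : ∀ g, u (vertex g) = permMat g)
    (he : ∀ g0 g1, g0 < g1 → ∀ t : I, ∃ M ∈ blockUnitary (edgeSetoid g0 g1),
      u (edgePt g0 g1 t) = permMat g0 * M.1) : Admissible n 1 u := by
  have hedge : ∀ g0 g1, g0 < g1 → ∀ x ∈ edgeSet g0 g1, ∀ g ∈ ({g0, g1} : Finset _), ∀ i j,
      ¬ sameOrbit (groupOf {g0, g1}) i j → u x (g i) j = 0 := by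
    intro g0 g1 hlt x hx g hg i j hij
    obtain ⟨t, rfl⟩ := exists_eq_edgePt hlt.ne hx
    obtain ⟨M, hM, hu⟩ := he g0 g1 hlt t
    rw [hu, permMat_mul_apply, ← Equiv.Perm.mul_apply]
    apply hM
    rw [Finset.mem_insert, Finset.mem_singleton] at hg
    rcases hg with rfl | rfl
    · rwa [inv_mul_cancel, Equiv.Perm.one_apply]
    · exact fun h => hij ((edgeSetoid g0 g).trans (edgeSetoid_apply g0 g i) h)
  refine ⟨⟨hc, fun x hx => ?_, fun S hS hcard x hx hxS g hg i j hij => ?_⟩, hv⟩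
  · obtain ⟨g, rfl⟩ | ⟨g0, g1, hlt, t, rfl⟩ := eq_vertex_or_eq_edgePt hx
    · rw [hv]
      exact (permUnitary g).2
    · obtain ⟨M, -, hM⟩ := he g0 g1 hlt t
      rw [hM]
      exact mul_mem (permUnitary g0).2 M.2
  · have h4 := hS.card_pos
    obtain h | h : S.card = 1 ∨ S.card = 2 := by omega
    · obtain ⟨a, rfl⟩ := Finset.card_eq_one.1 h
      have hxa : x = vertex a := eq_vertex_of_mem_edgeSet ⟨hx.1, hx.2.1, fun h h' _ =>
        hxS h (by simpa using h')⟩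
      rw [Finset.mem_singleton] at hg
      subst hg
      rw [hxa, hv, permMat_apply, if_neg]
      intro hgij
      exact hij ⟨1, one_mem _, g.injective hgij⟩
    · obtain ⟨a, b, hab, rfl⟩ := Finset.card_eq_two.1 h
      rcases lt_or_gt_of_ne hab with hlt | hlt
      · exact hedge a b hlt x ⟨hx.1, hx.2.1, fun h h0 h1 => hxS h (by simp [h0, h1])⟩ g hg i j hij
      · rw [Finset.pair_comm] at hg hij
        exact hedge b a hlt x ⟨hx.1, hx.2.1, fun h h0 h1 => hxS h (by simp [h0, h1])⟩ g hg i j hij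

end Skeleton

section Gluing

variable {n : ℕ} [LinearOrder (Equiv.Perm (Fin n))] {X : Type*}

/-- The map on the `1`-skeleton equal to `permMat g₀ * Φ g₀ g₁` on the interior of each edge. -/
noncomputable def glueEdges
    (Φ : Equiv.Perm (Fin n) → Equiv.Perm (Fin n) → X × I → unitaryGroup (Fin n) ℂ)
    (x : X) (y : Equiv.Perm (Fin n) → ℝ) : Matrix (Fin n) (Fin n) ℂ :=
  open Classical in
  (∑ g, if y = vertex g then permMat g else 0) +
    ∑ p : Equiv.Perm (Fin n) × Equiv.Perm (Fin n), if p.1 < p.2 ∧ y p.1 ≠ 0 ∧ y p.2 ≠ 0 then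
      permMat p.1 * (Φ p.1 p.2 (x, Set.projIcc 0 1 zero_le_one (y p.2))).1 else 0

variable {Φ : Equiv.Perm (Fin n) → Equiv.Perm (Fin n) → X × I → unitaryGroup (Fin n) ℂ}

theorem glueEdges_vertex (x : X) (g : Equiv.Perm (Fin n)) :
    glueEdges Φ x (vertex g) = permMat g := by
  classical
  rw [glueEdges, Finset.sum_eq_single g, Finset.sum_eq_zero, if_pos rfl, add_zero]
  · rintro ⟨a, b⟩ -
    rw [if_neg]
    rintro ⟨hab, ha, hb⟩
    have ha' : a = g := by_contra fun h => ha (vertex_of_ne h)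
    have hb' : b = g := by_contra fun h => hb (vertex_of_ne h)
    exact hab.ne (ha'.trans hb'.symm)
  · intro h _ hne
    rw [if_neg]
    intro heq
    have := congrFun heq g
    rw [vertex_self, vertex_of_ne hne.symm] at this
    exact one_ne_zero this
  · simp

theorem glueEdges_edgePt {g0 g1 : Equiv.Perm (Fin n)} (hlt : g0 < g1)
    (h0 : ∀ x, Φ g0 g1 (x, 0) = 1) (h1 : ∀ x, Φ g0 g1 (x, 1) = permUnitary (g0⁻¹ * g1))
    (x : X) (t : I) : glueEdges Φ x (edgePt g0 g1 t) = permMat g0 * (Φ g0 g1 (x, t)).1 := by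
  classical
  by_cases ht0 : t = 0
  · rw [ht0, Set.Icc.coe_zero, edgePt_zero, glueEdges_vertex, h0, OneMemClass.coe_one, mul_one]
  by_cases ht1 : t = 1
  · rw [ht1, Set.Icc.coe_one, edgePt_one, glueEdges_vertex, h1, coe_permUnitary, ← permMat_mul,
      mul_inv_cancel_left]
  have e0 : edgePt g0 g1 t g0 ≠ 0 := by
    rw [edgePt_left hlt.ne]
    exact fun h => ht1 (Subtype.ext (by simpa using (sub_eq_zero.1 h).symm))
  have e1 : edgePt g0 g1 t g1 ≠ 0 := by
    rw [edgePt_right hlt.ne]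
    exact fun h => ht0 (Subtype.ext h)
  rw [glueEdges, Finset.sum_eq_zero, Finset.sum_eq_single (g0, g1), if_pos ⟨hlt, e0, e1⟩, zero_add,
    edgePt_right hlt.ne, Set.projIcc_val]
  · rintro ⟨a, b⟩ - hne
    rw [if_neg]
    rintro ⟨hab, ha, hb⟩
    have key : ∀ c, edgePt g0 g1 t c ≠ 0 → c = g0 ∨ c = g1 := fun c hc => by
      by_contra! h
      exact hc (edgePt_of_ne h.1 h.2 _)
    rcases key a ha with rfl | rfl <;> rcases key b hb with rfl | rfl
    · exact hab.ne rfl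
    · exact hne rfl
    · exact hab.not_gt hlt
    · exact hab.ne rfl
  · simp
  · intro g _
    rw [if_neg]
    intro heq
    rw [heq] at e0 e1
    have ha' : g0 = g := by_contra fun h => e0 (vertex_of_ne h)
    have hb' : g1 = g := by_contra fun h => e1 (vertex_of_ne h)
    exact hlt.ne (ha'.trans hb'.symm)

theorem continuousOn_glueEdges [TopologicalSpace X] (hΦ : ∀ g0 g1, g0 < g1 → Continuous (Φ g0 g1))
    (h0 : ∀ g0 g1, g0 < g1 → ∀ x, Φ g0 g1 (x, 0) = 1)
    (h1 : ∀ g0 g1, g0 < g1 → ∀ x, Φ g0 g1 (x, 1) = permUnitary (g0⁻¹ * g1)) :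
    ContinuousOn (fun p : X × (Equiv.Perm (Fin n) → ℝ) => glueEdges Φ p.1 p.2)
      (Set.univ ×ˢ skel n 1) := by
  have hcover : (Set.univ : Set X) ×ˢ skel n 1 ⊆
      ⋃ q : {q : Equiv.Perm (Fin n) × Equiv.Perm (Fin n) // q.1 ≤ q.2},
        (Set.univ : Set X) ×ˢ edgeSet q.1.1 q.1.2 := by
    rintro ⟨x, y⟩ ⟨-, hy⟩
    obtain ⟨g0, g1, hle, hy⟩ := exists_mem_edgeSet hy
    exact Set.mem_iUnion.2 ⟨⟨(g0, g1), hle⟩, trivial, hy⟩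
  refine ContinuousOn.mono ((locallyFinite_of_finite _).continuousOn_iUnion
    (fun q => isClosed_univ.prod (isClosed_edgeSet _ _)) ?_) hcover
  rintro ⟨⟨g0, g1⟩, hle⟩
  rcases hle.eq_or_lt with heq | hlt
  · change g0 = g1 at heq
    subst heq
    refine (continuousOn_const (c := permMat g0)).congr ?_
    rintro ⟨x, y⟩ ⟨-, hy⟩
    exact (congrArg (glueEdges Φ x) (eq_vertex_of_mem_edgeSet hy)).trans (glueEdges_vertex x g0)
  · change g0 < g1 at hlt
    have hc : Continuous fun p : X × (Equiv.Perm (Fin n) → ℝ) =>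
        permMat g0 * (Φ g0 g1 (p.1, Set.projIcc 0 1 zero_le_one (p.2 g1))).1 :=
      continuous_const.mul (continuous_subtype_val.comp ((hΦ g0 g1 hlt).comp
        (continuous_fst.prodMk (continuous_projIcc.comp (by fun_prop)))))
    refine hc.continuousOn.congr ?_
    rintro ⟨x, y⟩ ⟨-, hy⟩
    obtain ⟨t, rfl⟩ := exists_eq_edgePt hlt.ne hy
    simp only [glueEdges_edgePt hlt (h0 g0 g1 hlt) (h1 g0 g1 hlt), edgePt_right hlt.ne,
      Set.projIcc_val]

theorem admissible_glueEdges [TopologicalSpace X] (hΦ : ∀ g0 g1, g0 < g1 → Continuous (Φ g0 g1))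
    (hb : ∀ g0 g1, g0 < g1 → ∀ p, Φ g0 g1 p ∈ blockUnitary (edgeSetoid g0 g1))
    (h0 : ∀ g0 g1, g0 < g1 → ∀ x, Φ g0 g1 (x, 0) = 1)
    (h1 : ∀ g0 g1, g0 < g1 → ∀ x, Φ g0 g1 (x, 1) = permUnitary (g0⁻¹ * g1)) (x : X) :
    Admissible n 1 (glueEdges Φ x) := by
  refine admissible_of_edges ?_ (glueEdges_vertex x) fun g0 g1 hlt t =>
    ⟨_, hb g0 g1 hlt (x, t), glueEdges_edgePt hlt (h0 g0 g1 hlt) (h1 g0 g1 hlt) x t⟩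
  exact (continuousOn_glueEdges hΦ h0 h1).comp (f := fun y => (x, y)) (by fun_prop)
    fun y hy => ⟨trivial, hy⟩

end Gluing

section EdgePaths

variable {n : ℕ} {u : (Equiv.Perm (Fin n) → ℝ) → Matrix (Fin n) (Fin n) ℂ}

/-- The path attached to an edge, as a path in the unitary group. -/
noncomputable def edgeUnitary (u : (Equiv.Perm (Fin n) → ℝ) → Matrix (Fin n) (Fin n) ℂ)
    (g0 g1 : Equiv.Perm (Fin n)) (t : I) : unitaryGroup (Fin n) ℂ :=
  toUnitary (edgePath u g0 g1 t)

theorem edgePath_eq (u : (Equiv.Perm (Fin n) → ℝ) → Matrix (Fin n) (Fin n) ℂ)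
    (g0 g1 : Equiv.Perm (Fin n)) (t : ℝ) :
    edgePath u g0 g1 t = permMat g0⁻¹ * u (edgePt g0 g1 t) := by
  ext i j
  rw [permMat_mul_apply, inv_inv]
  rfl

theorem Admissible.edgePath_mem (hu : Admissible n 1 u) (g0 g1 : Equiv.Perm (Fin n)) (t : I) :
    edgePath u g0 g1 t ∈ unitaryGroup (Fin n) ℂ := by
  rw [edgePath_eq]
  exact mul_mem (permUnitary g0⁻¹).2
    (hu.1.2.1 _ (edgeSet_subset_skel _ _ (edgePt_mem_edgeSet g0 g1 t)))

theorem Admissible.coe_edgeUnitary (hu : Admissible n 1 u) (g0 g1 : Equiv.Perm (Fin n)) (t : I) :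
    (edgeUnitary u g0 g1 t).1 = edgePath u g0 g1 t :=
  coe_toUnitary (hu.edgePath_mem g0 g1 t)

theorem Admissible.apply_edgePt (hu : Admissible n 1 u) (g0 g1 : Equiv.Perm (Fin n)) (t : I) :
    u (edgePt g0 g1 t) = permMat g0 * (edgeUnitary u g0 g1 t).1 := by
  rw [hu.coe_edgeUnitary, edgePath_eq, ← mul_assoc, ← permMat_mul, mul_inv_cancel, permMat_one,
    one_mul]

theorem Admissible.edgeUnitary_mem (hu : Admissible n 1 u) (g0 g1 : Equiv.Perm (Fin n)) (t : I) :
    edgeUnitary u g0 g1 t ∈ blockUnitary (edgeSetoid g0 g1) := by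
  intro i j hij
  rw [hu.coe_edgeUnitary]
  have hx := edgePt_mem_edgeSet g0 g1 t
  refine hu.1.2.2 {g0, g1} (by simp) Finset.card_le_two _ (edgeSet_subset_skel _ _ hx)
    (fun g hg => ?_) g0 (by simp) i j hij
  simp only [Finset.mem_insert, Finset.mem_singleton, not_or] at hg
  exact hx.2.2 g hg.1 hg.2

theorem Admissible.edgeUnitary_zero (hu : Admissible n 1 u) (g0 g1 : Equiv.Perm (Fin n)) :
    edgeUnitary u g0 g1 0 = 1 := by
  apply Subtype.ext
  rw [hu.coe_edgeUnitary, edgePath_eq, Set.Icc.coe_zero, edgePt_zero, hu.2, ← permMat_mul,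
    inv_mul_cancel, permMat_one, OneMemClass.coe_one]

theorem Admissible.edgeUnitary_one (hu : Admissible n 1 u) (g0 g1 : Equiv.Perm (Fin n)) :
    edgeUnitary u g0 g1 1 = permUnitary (g0⁻¹ * g1) := by
  apply Subtype.ext
  rw [hu.coe_edgeUnitary, edgePath_eq, Set.Icc.coe_one, edgePt_one, hu.2, ← permMat_mul]
  rfl

theorem continuous_edgeUnitary {X : Type*} [TopologicalSpace X]
    {H : X → (Equiv.Perm (Fin n) → ℝ) → Matrix (Fin n) (Fin n) ℂ}
    (hH : ContinuousOn (fun p : X × (Equiv.Perm (Fin n) → ℝ) => H p.1 p.2) (Set.univ ×ˢ skel n 1))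
    (hadm : ∀ x, Admissible n 1 (H x)) (g0 g1 : Equiv.Perm (Fin n)) :
    Continuous fun p : X × I => edgeUnitary (H p.1) g0 g1 p.2 := by
  refine continuous_toUnitary ?_ fun p => (hadm p.1).edgePath_mem g0 g1 p.2
  simp only [edgePath_eq]
  refine continuous_const.mul (hH.comp_continuous (f := fun p : X × I => (p.1, edgePt g0 g1 p.2))
    (continuous_fst.prodMk ?_) fun p => ⟨trivial, ?_⟩)
  · unfold edgePt
    fun_prop
  · exact edgeSet_subset_skel _ _ (edgePt_mem_edgeSet g0 g1 p.2)

theorem Admissible.continuous_edgeUnitary (hu : Admissible n 1 u) (g0 g1 : Equiv.Perm (Fin n)) :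
    Continuous (edgeUnitary u g0 g1) := by
  refine continuous_toUnitary (M := fun t : I => edgePath u g0 g1 t) ?_ (hu.edgePath_mem g0 g1)
  simp only [edgePath_eq]
  refine continuous_const.mul (hu.1.1.comp_continuous (f := fun t : I => edgePt g0 g1 t) ?_
    fun t => edgeSet_subset_skel _ _ (edgePt_mem_edgeSet g0 g1 t))
  unfold edgePt
  fun_prop

/-- The determinant of a block of a block diagonal unitary matrix. -/
noncomputable def blockCircle (B : Finset (Fin n)) (M : unitaryGroup (Fin n) ℂ) : Circle :=
  circleDet (unitaryRestrict B M)

theorem Admissible.isLiftOn_iff (hu : Admissible n 1 u) {g0 g1 : Equiv.Perm (Fin n)}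
    {B : Finset (Fin n)} (hB : IsBlock (edgeSetoid g0 g1) B) {l : ℝ → ℝ} :
    IsLiftOn (fun t => blockDet B (edgePath u g0 g1 t)) l ↔ ContinuousOn l (Set.Icc 0 1) ∧
      ∀ t : I, blockCircle B (edgeUnitary u g0 g1 t) = Circle.exp (2 * Real.pi * l t) := by
  refine and_congr_right fun _ => ?_
  rw [Subtype.forall]
  refine forall₂_congr fun t ht => ?_
  rw [← Circle.coe_inj, blockCircle, coe_circleDet_unitaryRestrict hB (hu.edgeUnitary_mem _ _ _),
    hu.coe_edgeUnitary, Circle.coe_exp]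
  push_cast
  rw [mul_right_comm]

end EdgePaths

section Winding

theorem continuousOn_comp_projIcc {Y Z : Type*} [TopologicalSpace Y] [TopologicalSpace Z]
    {H : I → Y → Z} {S : Set Y}
    (h : ContinuousOn (fun p : I × Y => H p.1 p.2) (Set.univ ×ˢ S)) :
    ContinuousOn (fun p : ℝ × Y => H (Set.projIcc 0 1 zero_le_one p.1) p.2)
      (Set.Icc 0 1 ×ˢ S) := by
  have hp : Continuous (Set.projIcc (0 : ℝ) 1 zero_le_one) := continuous_projIcc
  have hm : Continuous fun p : ℝ × Y => (Set.projIcc (0 : ℝ) 1 zero_le_one p.1, p.2) := by fun_prop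
  exact h.comp hm.continuousOn fun p hp => ⟨trivial, hp.2⟩

theorem exists_lift_unitInterval {f : I → Circle} (hf : Continuous f) :
    ∃ l : ℝ → ℝ, Continuous l ∧ ∀ t : I, f t = Circle.exp (2 * Real.pi * l t) := by
  obtain ⟨l, hl, h⟩ := exists_lift (hf.comp (continuous_projIcc (h := zero_le_one' ℝ)))
  refine ⟨l, hl, fun t => ?_⟩
  rw [← h, Function.comp_apply, Set.projIcc_val]

/-- Homotopic paths on the circle with fixed endpoints have the same winding number. -/
theorem lift_sub_eq_of_homotopy {D : I × I → Circle} (hD : Continuous D)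
    (h0 : ∀ s, D (s, 0) = D (0, 0)) (h1 : ∀ s, D (s, 1) = D (0, 1)) {l l' : ℝ → ℝ}
    (hl : ContinuousOn l (Set.Icc 0 1)) (hl' : ContinuousOn l' (Set.Icc 0 1))
    (h : ∀ t : I, D (0, t) = Circle.exp (2 * Real.pi * l t))
    (h' : ∀ t : I, D (1, t) = Circle.exp (2 * Real.pi * l' t)) : l 1 - l 0 = l' 1 - l' 0 := by
  have hproj : Continuous (Set.projIcc (0 : ℝ) 1 zero_le_one) := continuous_projIcc
  obtain ⟨L, hL, hLD⟩ := exists_lift (E := ℝ × ℝ) (f := fun p =>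
    D (Set.projIcc 0 1 zero_le_one p.1, Set.projIcc 0 1 zero_le_one p.2)) (by fun_prop)
  have hLI : ∀ s t : I, D (s, t) = Circle.exp (2 * Real.pi * L (s, t)) := fun s t => by
    rw [← hLD, Set.projIcc_val, Set.projIcc_val]
  have m0 : (0 : ℝ) ∈ Set.Icc (0 : ℝ) 1 := by simp
  have m1 : (1 : ℝ) ∈ Set.Icc (0 : ℝ) 1 := by simp
  have e0 := lift_sub_eq_sub isPreconnected_Icc hl (l' := fun t => L (0, t)) (by fun_prop)
    (fun t ht => by rw [← h ⟨t, ht⟩, hLI, Set.Icc.coe_zero]) m0 m1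
  have e1 := lift_sub_eq_sub isPreconnected_Icc hl' (l' := fun t => L (1, t)) (by fun_prop)
    (fun t ht => by rw [← h' ⟨t, ht⟩, hLI, Set.Icc.coe_one]) m0 m1
  have f0 := lift_sub_eq_sub isPreconnected_Icc (l := fun s => L (s, 0))
    (l' := fun _ => L (0, 0)) (by fun_prop) (by fun_prop)
    (fun s hs => by
      have := (hLI ⟨s, hs⟩ 0).symm.trans ((h0 _).trans (hLI 0 0))
      simpa using this) m0 m1
  have f1 := lift_sub_eq_sub isPreconnected_Icc (l := fun s => L (s, 1))
    (l' := fun _ => L (0, 1)) (by fun_prop) (by fun_prop)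
    (fun s hs => by
      have := (hLI ⟨s, hs⟩ 1).symm.trans ((h1 _).trans (hLI 0 1))
      simpa using this) m0 m1
  linarith

/-- Two lifts whose endpoints project to the same points, with equal upper winding numbers,
have equal winding numbers. -/
theorem sub_eq_of_ceil_eq {a b a' b' : ℝ}
    (h0 : Circle.exp (2 * Real.pi * a) = Circle.exp (2 * Real.pi * a'))
    (h1 : Circle.exp (2 * Real.pi * b) = Circle.exp (2 * Real.pi * b'))
    (h : ⌈b - a⌉ = ⌈b' - a'⌉) : b - a = b' - a' := by
  have key : ∀ {x y : ℝ}, Circle.exp (2 * Real.pi * x) = Circle.exp (2 * Real.pi * y) →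
      ∃ m : ℤ, x = y + m := fun {x y} hxy => by
    obtain ⟨m, hm⟩ := Circle.exp_eq_exp.1 hxy
    refine ⟨m, mul_left_cancel₀ Real.two_pi_pos.ne' ?_⟩
    linear_combination hm
  obtain ⟨p, hp⟩ := key h0
  obtain ⟨q, hq⟩ := key h1
  have e : b - a = (b' - a') + ((q - p : ℤ) : ℝ) := by
    rw [hp, hq]
    push_cast
    ring
  rw [e, Int.ceil_add_intCast] at h
  have : q - p = 0 := by omega
  rw [e, this, Int.cast_zero, add_zero]

end Winding

section BlockWinding

variable {n : ℕ} {r : Setoid (Fin n)} {B : Finset (Fin n)}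

theorem blockCircle_mul (hB : IsBlock r B) {M N : unitaryGroup (Fin n) ℂ}
    (hM : M ∈ blockUnitary r) (hN : N ∈ blockUnitary r) :
    blockCircle B (M * N) = blockCircle B M * blockCircle B N := by
  rw [blockCircle, unitaryRestrict_mul hB hM hN, map_mul]
  rfl

theorem blockCircle_inv (hB : IsBlock r B) {M : unitaryGroup (Fin n) ℂ}
    (hM : M ∈ blockUnitary r) : blockCircle B M⁻¹ = (blockCircle B M)⁻¹ := by
  rw [blockCircle, unitaryRestrict_inv hB hM, map_inv]
  rfl

theorem continuous_blockCircle {X : Type*} [TopologicalSpace X] (hB : IsBlock r B)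
    {M : X → unitaryGroup (Fin n) ℂ} (hM : Continuous M) (h : ∀ x, M x ∈ blockUnitary r) :
    Continuous fun x => blockCircle B (M x) :=
  continuous_circleDet.comp (continuous_unitaryRestrict hB hM h)

theorem diagUnitary_mem_blockUnitary (r : Setoid (Fin n)) (z : Fin n → Circle) :
    diagUnitary z ∈ blockUnitary r := by
  intro i j hij
  rw [coe_diagUnitary, diagonal_apply_ne]
  rintro rfl
  exact hij (r.refl i)

theorem blockCircle_diagUnitary (hB : IsBlock r B) (z : Fin n → Circle) :
    blockCircle B (diagUnitary z) = ∏ i ∈ B, z i := by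
  have : unitaryRestrict B (diagUnitary z) = diagUnitary fun i => if i ∈ B then z i else 1 := by
    apply Subtype.ext
    rw [coe_unitaryRestrict hB (diagUnitary_mem_blockUnitary r z), coe_diagUnitary,
      coe_diagUnitary]
    ext i j
    by_cases hij : i = j
    · subst hij
      by_cases hi : i ∈ B <;> simp [blockRestrict, hi]
    · simp [blockRestrict, hij]
  rw [blockCircle, this, circleDet_diagUnitary, Finset.prod_ite_mem, Finset.univ_inter]

/-- Two paths with the same endpoints and the same block winding numbers are homotopic relative
to the endpoints. -/
theorem exists_homotopy_of_lifts {γ γ' : I → unitaryGroup (Fin n) ℂ} (hγ : Continuous γ)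
    (hγ' : Continuous γ') (hγr : ∀ t, γ t ∈ blockUnitary r) (hγr' : ∀ t, γ' t ∈ blockUnitary r)
    (h0 : γ 0 = γ' 0) (h1 : γ 1 = γ' 1)
    (hl : ∀ B, IsBlock r B → ∃ l l' : ℝ → ℝ, Continuous l ∧ Continuous l' ∧
      (∀ t : I, blockCircle B (γ t) = Circle.exp (2 * Real.pi * l t)) ∧
      (∀ t : I, blockCircle B (γ' t) = Circle.exp (2 * Real.pi * l' t)) ∧
      l 1 - l 0 = l' 1 - l' 0) :
    ∃ Φ : I × I → unitaryGroup (Fin n) ℂ, Continuous Φ ∧ (∀ p, Φ p ∈ blockUnitary r) ∧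
      (∀ t, Φ (0, t) = γ t) ∧ (∀ t, Φ (1, t) = γ' t) ∧ (∀ s, Φ (s, 0) = γ 0) ∧
      ∀ s, Φ (s, 1) = γ 1 := by
  obtain ⟨K, k1, k2, k3, k4, k5, k6⟩ := nullLoop_blockUnitary (r := r)
    (γ := fun t => (γ t)⁻¹ * γ' t) (hγ.inv.mul hγ') (fun t => mul_mem (inv_mem (hγr t)) (hγr' t))
    (by simp [h0]) (by simp [h1]) fun B hB => by
      obtain ⟨l, l', c, c', e, e', hll⟩ := hl B hB
      refine ⟨fun t => 2 * Real.pi * (l' t - l t - (l' 0 - l 0)), by fun_prop, by simp, ?_,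
        fun t => ?_⟩
      · beta_reduce
        rw [Set.Icc.coe_one]
        linear_combination (-2 * Real.pi) * hll
      · have hz : Circle.exp (2 * Real.pi * l 0) = Circle.exp (2 * Real.pi * l' 0) := by
          have a := e 0
          have a' := e' 0
          rw [Set.Icc.coe_zero] at a a'
          rw [← a, ← a', h0]
        change blockCircle B _ = Circle.exp (2 * Real.pi * (l' t - l t - (l' 0 - l 0)))
        rw [blockCircle_mul hB (inv_mem (hγr t)) (hγr' t), blockCircle_inv hB (hγr t), e, e',
          mul_sub, mul_sub, mul_sub, Circle.exp_sub, Circle.exp_sub, Circle.exp_sub, hz,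
          div_self', div_one, mul_comm, div_eq_mul_inv]
  refine ⟨fun p => γ p.2 * K (unitInterval.symm p.1, p.2), by fun_prop,
    fun p => mul_mem (hγr _) (k2 _), ?_, ?_, ?_, ?_⟩
  · intro t
    simp [k4]
  · intro t
    simp [k3]
  · intro s
    simp [k5]
  · intro s
    simp [k6]

/-- Every tuple of integers is realised by the upper winding numbers of a path. -/
theorem exists_path_with_winding {g : Equiv.Perm (Fin n)} (hg : ∀ i, r i (g i))
    (m : Finset (Fin n) → ℤ) :
    ∃ γ : I → unitaryGroup (Fin n) ℂ, Continuous γ ∧ (∀ t, γ t ∈ blockUnitary r) ∧ γ 0 = 1 ∧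
      γ 1 = permUnitary g ∧ ∀ B, IsBlock r B → ∃ l : ℝ → ℝ, Continuous l ∧
        (∀ t : I, blockCircle B (γ t) = Circle.exp (2 * Real.pi * l t)) ∧ ⌈l 1 - l 0⌉ = m B := by
  classical
  obtain ⟨β, b1, b2, b3, b4⟩ := exists_path_perm g hg
  have hlift : ∀ B, ∃ l : ℝ → ℝ, IsBlock r B → Continuous l ∧
      ∀ t : I, blockCircle B (β t) = Circle.exp (2 * Real.pi * l t) := fun B => by
    by_cases hB : IsBlock r B
    · obtain ⟨l, hl⟩ := exists_lift_unitInterval (continuous_blockCircle hB b1 b2)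
      exact ⟨l, fun _ => hl⟩
    · exact ⟨0, fun h => absurd h hB⟩
  choose l hl using hlift
  let k : Finset (Fin n) → ℤ := fun B => m B - ⌈l B 1 - l B 0⌉
  let z : I → Fin n → Circle := fun t i => if ∀ j, r i j → i ≤ j then
    Circle.exp (2 * Real.pi * (k (Finset.univ.filter (r i)) * (t : ℝ))) else 1
  have hz0 : z 0 = 1 := by
    funext i
    simp [z]
  have hz1 : z 1 = 1 := by
    funext i
    have : ∀ a : ℤ, Circle.exp (2 * Real.pi * (a * 1)) = 1 := fun a => by
      rw [mul_one, mul_comm, Circle.exp_int_mul_two_pi]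
    simp only [z, Set.Icc.coe_one, this, ite_self, Pi.one_apply]
  have hzc : Continuous z := by
    refine continuous_pi fun i => ?_
    by_cases h : ∀ j, r i j → i ≤ j
    · simp only [z, if_pos h]
      fun_prop
    · simp only [z, if_neg h]
      fun_prop
  refine ⟨fun t => β t * diagUnitary (z t), b1.mul (continuous_diagUnitary.comp hzc),
    fun t => mul_mem (b2 t) (diagUnitary_mem_blockUnitary r _),
    by simp only [b3, hz0, map_one, mul_one],
    by simp only [b4, hz1, map_one, mul_one], fun B hB => ?_⟩
  obtain ⟨c, e⟩ := hl B hB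
  refine ⟨fun t => l B t + k B * t, by fun_prop, fun t => ?_, ?_⟩
  · have hb := B.min'_mem hB.nonempty
    have hprod : ∏ i ∈ B, z t i = Circle.exp (2 * Real.pi * (k B * (t : ℝ))) := by
      rw [Finset.prod_eq_single (B.min' hB.nonempty)]
      · have hB' : Finset.univ.filter (r (B.min' hB.nonempty)) = B := by
          ext j
          rw [Finset.mem_filter, hB.mem_iff hb]
          simp
        simp only [z]
        rw [if_pos fun j hj => B.min'_le j ((hB.mem_iff hb).2 hj), hB']
      · intro i hi hne
        simp only [z]
        rw [if_neg]
        exact fun h => hne (le_antisymm (h _ ((hB.mem_iff hi).1 hb)) (B.min'_le i hi))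
      · exact fun h => absurd hb h
    rw [blockCircle_mul hB (b2 t) (diagUnitary_mem_blockUnitary r _), e,
      blockCircle_diagUnitary hB, hprod, mul_add, Circle.exp_add]
  · have : l B 1 + k B * 1 - (l B 0 + k B * 0) = (l B 1 - l B 0) + (k B : ℤ) := by ring
    rw [this, Int.ceil_add_intCast]
    simp only [k]
    ring

end BlockWinding

section Classification

variable {n : ℕ}

/-- Upper winding numbers are invariant under homotopies through admissible maps. -/
theorem AdmHomotopic.ceil_eq {u u' : (Equiv.Perm (Fin n) → ℝ) → Matrix (Fin n) (Fin n) ℂ}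
    (hu : Admissible n 1 u) (hu' : Admissible n 1 u') (hH : AdmHomotopic n u u')
    {g0 g1 : Equiv.Perm (Fin n)} {B : Finset (Fin n)}
    (hB : IsBlock (sameOrbit (groupOf {g0, g1})) B)
    {l l' : ℝ → ℝ} (hl : IsLiftOn (fun t => blockDet B (edgePath u g0 g1 t)) l)
    (hl' : IsLiftOn (fun t => blockDet B (edgePath u' g0 g1 t)) l') :
    ⌈l 1 - l 0⌉ = ⌈l' 1 - l' 0⌉ := by
  obtain ⟨H, hHc, hHadm, hH0, hH1⟩ := hH
  have hB' : IsBlock (edgeSetoid g0 g1) B := hB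
  obtain ⟨c, e⟩ := (hu.isLiftOn_iff hB').1 hl
  obtain ⟨c', e'⟩ := (hu'.isLiftOn_iff hB').1 hl'
  have hadm : ∀ s : I, Admissible n 1 (H s) := fun s => hHadm s s.2
  have hc : ContinuousOn (fun p : I × (Equiv.Perm (Fin n) → ℝ) => H p.1 p.2)
      (Set.univ ×ˢ skel n 1) := by
    have hm : Continuous fun p : I × (Equiv.Perm (Fin n) → ℝ) => ((p.1 : ℝ), p.2) := by fun_prop
    exact hHc.comp hm.continuousOn fun p hp => ⟨p.1.2, hp.2⟩
  have hEU := continuous_edgeUnitary hc hadm g0 g1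
  have hval : ∀ {s : I} {v : (Equiv.Perm (Fin n) → ℝ) → Matrix (Fin n) (Fin n) ℂ},
      (∀ x ∈ skel n 1, H s x = v x) →
        ∀ t : I, edgeUnitary (H s) g0 g1 t = edgeUnitary v g0 g1 t :=
    fun {s v} h t => by
      rw [edgeUnitary, edgeUnitary, edgePath_eq, edgePath_eq,
        h _ (edgeSet_subset_skel _ _ (edgePt_mem_edgeSet g0 g1 t))]
  rw [lift_sub_eq_of_homotopy (continuous_blockCircle hB' hEU fun p =>
    (hadm p.1).edgeUnitary_mem g0 g1 p.2) (fun s => ?_) (fun s => ?_) c c' (fun t => ?_)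
    (fun t => ?_)]
  · simp only [(hadm _).edgeUnitary_zero]
  · simp only [(hadm _).edgeUnitary_one]
  · rw [← e, hval (s := 0) hH0]
  · rw [← e', hval (s := 1) hH1]

/-- Admissible maps with the same upper winding numbers are homotopic. -/
theorem admHomotopic_of_ceil_eq [LinearOrder (Equiv.Perm (Fin n))]
    {u u' : (Equiv.Perm (Fin n) → ℝ) → Matrix (Fin n) (Fin n) ℂ}
    (hu : Admissible n 1 u) (hu' : Admissible n 1 u')
    (h : ∀ g0 g1 : Equiv.Perm (Fin n), g0 < g1 →
      ∀ B : Finset (Fin n), IsBlock (sameOrbit (groupOf {g0, g1})) B →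
        ∀ l l' : ℝ → ℝ,
          IsLiftOn (fun t => blockDet B (edgePath u g0 g1 t)) l →
          IsLiftOn (fun t => blockDet B (edgePath u' g0 g1 t)) l' →
          ⌈l 1 - l 0⌉ = ⌈l' 1 - l' 0⌉) :
    AdmHomotopic n u u' := by
  have key : ∀ g0 g1 : Equiv.Perm (Fin n), ∃ Φ : I × I → unitaryGroup (Fin n) ℂ, g0 < g1 →
      Continuous Φ ∧ (∀ p, Φ p ∈ blockUnitary (edgeSetoid g0 g1)) ∧
      (∀ t, Φ (0, t) = edgeUnitary u g0 g1 t) ∧ (∀ t, Φ (1, t) = edgeUnitary u' g0 g1 t) ∧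
      (∀ s, Φ (s, 0) = 1) ∧ ∀ s, Φ (s, 1) = permUnitary (g0⁻¹ * g1) := by
    intro g0 g1
    by_cases hlt : g0 < g1
    · obtain ⟨Φ, hΦ⟩ := exists_homotopy_of_lifts (hu.continuous_edgeUnitary g0 g1)
        (hu'.continuous_edgeUnitary g0 g1) (hu.edgeUnitary_mem g0 g1)
        (hu'.edgeUnitary_mem g0 g1)
        (by rw [hu.edgeUnitary_zero, hu'.edgeUnitary_zero])
        (by rw [hu.edgeUnitary_one, hu'.edgeUnitary_one]) fun B hB => by
          obtain ⟨l, c, e⟩ := exists_lift_unitInterval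
            (continuous_blockCircle hB (hu.continuous_edgeUnitary g0 g1) (hu.edgeUnitary_mem g0 g1))
          obtain ⟨l', c', e'⟩ := exists_lift_unitInterval (continuous_blockCircle hB
            (hu'.continuous_edgeUnitary g0 g1) (hu'.edgeUnitary_mem g0 g1))
          refine ⟨l, l', c, c', e, e', sub_eq_of_ceil_eq ?_ ?_ (h g0 g1 hlt B hB l l'
            ((hu.isLiftOn_iff hB).2 ⟨c.continuousOn, e⟩)
            ((hu'.isLiftOn_iff hB).2 ⟨c'.continuousOn, e'⟩))⟩
          · have a := e 0
            have a' := e' 0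
            rw [Set.Icc.coe_zero] at a a'
            rw [← a, ← a', hu.edgeUnitary_zero, hu'.edgeUnitary_zero]
          · have a := e 1
            have a' := e' 1
            rw [Set.Icc.coe_one] at a a'
            rw [← a, ← a', hu.edgeUnitary_one, hu'.edgeUnitary_one]
      rw [hu.edgeUnitary_zero, hu.edgeUnitary_one] at hΦ
      exact ⟨Φ, fun _ => hΦ⟩
    · exact ⟨fun _ => 1, fun h => absurd h hlt⟩
  choose Φ hΦ using key
  have hΦ0 : ∀ g0 g1, g0 < g1 → ∀ s, Φ g0 g1 (s, 0) = 1 := fun g0 g1 h => (hΦ g0 g1 h).2.2.2.2.1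
  have hΦ1 : ∀ g0 g1, g0 < g1 → ∀ s, Φ g0 g1 (s, 1) = permUnitary (g0⁻¹ * g1) :=
    fun g0 g1 h => (hΦ g0 g1 h).2.2.2.2.2
  have hval : ∀ {s : I} {v : (Equiv.Perm (Fin n) → ℝ) → Matrix (Fin n) (Fin n) ℂ},
      Admissible n 1 v → (∀ g0 g1, g0 < g1 → ∀ t, Φ g0 g1 (s, t) = edgeUnitary v g0 g1 t) →
      ∀ x ∈ skel n 1, glueEdges Φ s x = v x := by
    intro s v hv hsv x hx
    obtain ⟨g, rfl⟩ | ⟨g0, g1, hlt, t, rfl⟩ := eq_vertex_or_eq_edgePt hx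
    · rw [glueEdges_vertex, hv.2]
    · rw [glueEdges_edgePt hlt (hΦ0 _ _ hlt) (hΦ1 _ _ hlt), hsv g0 g1 hlt, hv.apply_edgePt]
  refine ⟨fun s => glueEdges Φ (Set.projIcc 0 1 zero_le_one s), ?_, fun s _ => ?_, ?_, ?_⟩
  · exact continuousOn_comp_projIcc (continuousOn_glueEdges (fun g0 g1 h => (hΦ g0 g1 h).1) hΦ0 hΦ1)
  · exact admissible_glueEdges (fun g0 g1 h => (hΦ g0 g1 h).1)
      (fun g0 g1 h => (hΦ g0 g1 h).2.1) hΦ0 hΦ1 _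
  · beta_reduce
    rw [Set.projIcc_left]
    exact hval hu fun g0 g1 h => (hΦ g0 g1 h).2.2.1
  · beta_reduce
    rw [Set.projIcc_right]
    exact hval hu' fun g0 g1 h => (hΦ g0 g1 h).2.2.2.1

/-- Every tuple of integers is the tuple of upper winding numbers of an admissible map. -/
theorem exists_admissible_ceil_eq [LinearOrder (Equiv.Perm (Fin n))]
    (m : Equiv.Perm (Fin n) → Equiv.Perm (Fin n) → Finset (Fin n) → ℤ) :
    ∃ u, Admissible n 1 u ∧
      ∀ g0 g1 : Equiv.Perm (Fin n), g0 < g1 →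
        ∀ B : Finset (Fin n), IsBlock (sameOrbit (groupOf {g0, g1})) B →
          ∃ l : ℝ → ℝ,
            IsLiftOn (fun t => blockDet B (edgePath u g0 g1 t)) l ∧
            ⌈l 1 - l 0⌉ = m g0 g1 B := by
  choose γ hγ using fun g0 g1 : Equiv.Perm (Fin n) =>
    exists_path_with_winding (edgeSetoid_apply g0 g1) (m g0 g1)
  have hΦ0 : ∀ g0 g1, g0 < g1 → ∀ s : Unit, γ g0 g1 (s, (0 : I)).2 = 1 :=
    fun g0 g1 _ _ => (hγ g0 g1).2.2.1
  have hΦ1 : ∀ g0 g1, g0 < g1 → ∀ s : Unit, γ g0 g1 (s, (1 : I)).2 = permUnitary (g0⁻¹ * g1) :=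
    fun g0 g1 _ _ => (hγ g0 g1).2.2.2.1
  have hadm : Admissible n 1 (glueEdges (fun g0 g1 p => γ g0 g1 p.2) ()) :=
    admissible_glueEdges (fun g0 g1 _ => (hγ g0 g1).1.comp continuous_snd)
      (fun g0 g1 _ p => (hγ g0 g1).2.1 p.2) hΦ0 hΦ1 ()
  refine ⟨_, hadm, fun g0 g1 hlt B hB => ?_⟩
  obtain ⟨l, c, e, hm⟩ := (hγ g0 g1).2.2.2.2 B hB
  refine ⟨l, (hadm.isLiftOn_iff (g0 := g0) (g1 := g1) hB).2 ⟨c.continuousOn, fun t => ?_⟩, hm⟩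
  rw [← e]
  congr 1
  apply Subtype.ext
  rw [hadm.coe_edgeUnitary, edgePath_eq,
    glueEdges_edgePt hlt (hΦ0 _ _ hlt) (hΦ1 _ _ hlt), ← mul_assoc, ← permMat_mul,
    inv_mul_cancel, permMat_one, one_mul]

end Classification

end

/-- the tuple of upper winding numbers `uwn_B(γ^{g₀,g₁})`, indexed by the
pairs of an edge `g₀ < g₁` of `Δ^{S_n}` and a block `B` of `𝒫(Δ^{g₀,g₁})`, induces a
well-defined bijection between homotopy classes of admissible maps on the 1-skeleton
(homotopies being through admissible maps) and `ℤ^C`. -/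
theorem admissible_one_skeleton_classified {n : ℕ} (hn : 1 ≤ n)
    [LinearOrder (Equiv.Perm (Fin n))] :
    (∀ u u', Admissible n 1 u → Admissible n 1 u' → AdmHomotopic n u u' →
      ∀ g0 g1 : Equiv.Perm (Fin n), g0 < g1 →
        ∀ B : Finset (Fin n), IsBlock (sameOrbit (groupOf {g0, g1})) B →
          ∀ l l' : ℝ → ℝ,
            IsLiftOn (fun t => blockDet B (edgePath u g0 g1 t)) l →
            IsLiftOn (fun t => blockDet B (edgePath u' g0 g1 t)) l' →
            ⌈l 1 - l 0⌉ = ⌈l' 1 - l' 0⌉) ∧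
    (∀ u u', Admissible n 1 u → Admissible n 1 u' →
      (∀ g0 g1 : Equiv.Perm (Fin n), g0 < g1 →
        ∀ B : Finset (Fin n), IsBlock (sameOrbit (groupOf {g0, g1})) B →
          ∀ l l' : ℝ → ℝ,
            IsLiftOn (fun t => blockDet B (edgePath u g0 g1 t)) l →
            IsLiftOn (fun t => blockDet B (edgePath u' g0 g1 t)) l' →
            ⌈l 1 - l 0⌉ = ⌈l' 1 - l' 0⌉) →
      AdmHomotopic n u u') ∧
    (∀ m : Equiv.Perm (Fin n) → Equiv.Perm (Fin n) → Finset (Fin n) → ℤ,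
      ∃ u, Admissible n 1 u ∧
        ∀ g0 g1 : Equiv.Perm (Fin n), g0 < g1 →
          ∀ B : Finset (Fin n), IsBlock (sameOrbit (groupOf {g0, g1})) B →
            ∃ l : ℝ → ℝ,
              IsLiftOn (fun t => blockDet B (edgePath u g0 g1 t)) l ∧
              ⌈l 1 - l 0⌉ = m g0 g1 B) := by
  refine ⟨fun u u' hu hu' hH g0 g1 _ B hB l l' hl hl' => hH.ceil_eq hu hu' hB hl hl',
    fun u u' hu hu' h => admHomotopic_of_ceil_eq hu hu' h, exists_admissible_ceil_eq⟩
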